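/- Suppose in addition that R is Henselian. Let μ : M → X be a homomorphism of finitely generated R-modules with X maximal Cohen–Macaulay. Then μ is a CM-envelope of M if and only if cod(ker μ) > 0 and there exists an exact sequence 0 → S → coker μ →u T → U → 0 of finitely generated R-modules such that cod S > 1, cod U > 2, T satisfies (S_2), T† has finite injective dimension and satisfies (S_3), and the image of u has no nonzero free direct summand. -/

import Mathlib

open CategoryTheory

noncomputable section

/-- `Ext^n_A(M, N)` as a module. -/
def ext1 (A : Type) [CommRing A] (n : ℕ) (M N : Type) [AddCommGroup M] [Module A M]
    [AddCommGroup N] [Module A N] : ModuleCat A :=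
  ((Ext A (ModuleCat A) n).obj (Opposite.op (ModuleCat.of A M))).obj (ModuleCat.of A N)

/-- The depth of a module over a local ring: the least `n` with `Ext^n(k, M) ≠ 0`
(`⊤` if no such `n`, e.g. for the zero module). -/
def rdepth (A : Type) [CommRing A] [IsLocalRing A] (M : Type) [AddCommGroup M] [Module A M] :
    ℕ∞ :=
  sInf {n : ℕ∞ | ∃ m : ℕ, n = m ∧ ¬ Subsingleton (ext1 A m (IsLocalRing.ResidueField A) M)}

/-- The dimension of a module, `dim M = dim (A / ann M)`. -/
def mdim (A : Type) [CommRing A] (M : Type) [AddCommGroup M] [Module A M] : WithBot ℕ∞ :=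
  ringKrullDim (A ⧸ Module.annihilator A M)

/-- `cod M > n`, i.e. `dim A - dim M > n`, i.e. `dim M + n < d`. -/
def codGT (A : Type) [CommRing A] (d : ℕ) (M : Type) [AddCommGroup M] [Module A M]
    (n : ℕ) : Prop :=
  mdim A M + n < (d : WithBot ℕ∞)

/-- `cod M ≥ n`, i.e. `dim M + n ≤ d`. -/
def codGE (A : Type) [CommRing A] (d : ℕ) (M : Type) [AddCommGroup M] [Module A M]
    (n : ℕ) : Prop :=
  mdim A M + n ≤ (d : WithBot ℕ∞)

/-- Maximal Cohen-Macaulay module over a `d`-dimensional local ring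
(the zero module counts as MCM). -/
def IsMCM (A : Type) [CommRing A] [IsLocalRing A] (d : ℕ) (M : Type) [AddCommGroup M]
    [Module A M] : Prop :=
  Module.Finite A M ∧ (d : ℕ∞) ≤ rdepth A M

/-- Serre's condition `(S_n)`: `depth M_p ≥ min {n, ht p}` for all primes `p`. -/
def SerreS (A : Type) [CommRing A] (n : ℕ) (M : Type) [AddCommGroup M] [Module A M] : Prop :=
  ∀ p : PrimeSpectrum A,
    min (n : WithBot ℕ∞) (ringKrullDim (Localization.AtPrime p.asIdeal))
      ≤ (rdepth (Localization.AtPrime p.asIdeal)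
          (LocalizedModule p.asIdeal.primeCompl M) : ℕ∞)

/-- Finite injective dimension: `Ext^m(-, M)` vanishes for all large `m`. -/
def HasFID (A : Type) [CommRing A] (M : Type) [AddCommGroup M] [Module A M] : Prop :=
  ∃ n : ℕ, ∀ (N : Type) [AddCommGroup N] [Module A N], ∀ m : ℕ, n < m →
    Subsingleton (ext1 A m N M)

/-- `ω` is a canonical module of the `d`-dimensional local ring `A`:
it is maximal Cohen-Macaulay, of finite injective dimension, and of type one. -/
def IsCanonicalModule (A : Type) [CommRing A] [IsLocalRing A] (d : ℕ) (ω : Type)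
    [AddCommGroup ω] [Module A ω] : Prop :=
  IsMCM A d ω ∧ HasFID A ω ∧
    Nonempty ((ext1 A d (IsLocalRing.ResidueField A) ω) ≃ₗ[A] IsLocalRing.ResidueField A)

/-- `μ : M → X` is a CM-preenvelope. -/
def IsCMPreenvelope (A : Type) [CommRing A] [IsLocalRing A] (d : ℕ) {M X : Type}
    [AddCommGroup M] [Module A M] [AddCommGroup X] [Module A X] (μ : M →ₗ[A] X) : Prop :=
  IsMCM A d X ∧ ∀ (Z : Type) [AddCommGroup Z] [Module A Z], IsMCM A d Z →
    ∀ f : M →ₗ[A] Z, ∃ g : X →ₗ[A] Z, g ∘ₗ μ = f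

/-- `μ : M → X` is a special CM-preenvelope: a CM-preenvelope with
`Ext^1(coker μ, Z) = 0` for all maximal Cohen-Macaulay `Z`. -/
def IsSpecialCMPreenvelope (A : Type) [CommRing A] [IsLocalRing A] (d : ℕ) {M X : Type}
    [AddCommGroup M] [Module A M] [AddCommGroup X] [Module A X] (μ : M →ₗ[A] X) : Prop :=
  IsCMPreenvelope A d μ ∧ ∀ (Z : Type) [AddCommGroup Z] [Module A Z], IsMCM A d Z →
    Subsingleton (ext1 A 1 (X ⧸ LinearMap.range μ) Z)

/-- `μ : M → X` is a CM-envelope. -/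
def IsCMEnvelope (A : Type) [CommRing A] [IsLocalRing A] (d : ℕ) {M X : Type}
    [AddCommGroup M] [Module A M] [AddCommGroup X] [Module A X] (μ : M →ₗ[A] X) : Prop :=
  IsCMPreenvelope A d μ ∧ ∀ φ : X →ₗ[A] X, φ ∘ₗ μ = μ → Function.Bijective φ

/-- `π : X → M` is a CM-precover. -/
def IsCMPrecover (A : Type) [CommRing A] [IsLocalRing A] (d : ℕ) {X M : Type}
    [AddCommGroup X] [Module A X] [AddCommGroup M] [Module A M] (π : X →ₗ[A] M) : Prop :=
  IsMCM A d X ∧ ∀ (Z : Type) [AddCommGroup Z] [Module A Z], IsMCM A d Z →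
    ∀ f : Z →ₗ[A] M, ∃ g : Z →ₗ[A] X, π ∘ₗ g = f

/-- `π : X → M` is a special CM-precover: a CM-precover with
`Ext^1(Z, ker π) = 0` for all maximal Cohen-Macaulay `Z`. -/
def IsSpecialCMPrecover (A : Type) [CommRing A] [IsLocalRing A] (d : ℕ) {X M : Type}
    [AddCommGroup X] [Module A X] [AddCommGroup M] [Module A M] (π : X →ₗ[A] M) : Prop :=
  IsCMPrecover A d π ∧ ∀ (Z : Type) [AddCommGroup Z] [Module A Z], IsMCM A d Z →
    Subsingleton (ext1 A 1 Z ↥(LinearMap.ker π))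

/-- `π : X → M` is a CM-cover. -/
def IsCMCover (A : Type) [CommRing A] [IsLocalRing A] (d : ℕ) {X M : Type}
    [AddCommGroup X] [Module A X] [AddCommGroup M] [Module A M] (π : X →ₗ[A] M) : Prop :=
  IsCMPrecover A d π ∧ ∀ φ : X →ₗ[A] X, π ∘ₗ φ = π → Function.Bijective φ

/-- `M` has no nonzero free direct summand. -/
def NoNonzeroFreeSummand (A : Type) [CommRing A] (M : Type) [AddCommGroup M]
    [Module A M] : Prop :=
  ∀ F G : Submodule A M, IsCompl F G → Module.Free A ↥F → F = ⊥

/-- `W` belongs to `add ω`: it is a direct summand of a finite direct sum of copies of `ω`. -/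
def InAdd (A : Type) [CommRing A] (ω : Type) [AddCommGroup ω] [Module A ω] (W : Type)
    [AddCommGroup W] [Module A W] : Prop :=
  ∃ (n : ℕ) (W' : ModuleCat.{0} A), Nonempty ((W × ↥W') ≃ₗ[A] (Fin n → ω))

section delta

variable (A : Type) [CommRing A] (ω : Type) [AddCommGroup ω] [Module A ω]

/-- The natural evaluation map `δ_M : M → M†† = Hom(Hom(M, ω), ω)`. -/
def deltaMap (M : Type) [AddCommGroup M] [Module A M] :
    M →ₗ[A] ((M →ₗ[A] ω) →ₗ[A] ω) :=
  (LinearMap.id : (M →ₗ[A] ω) →ₗ[A] (M →ₗ[A] ω)).flip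

/-- The dual `f† = Hom(f, ω)` of a linear map `f`. -/
def dmap {M N : Type} [AddCommGroup M] [Module A M] [AddCommGroup N] [Module A N]
    (f : M →ₗ[A] N) : (N →ₗ[A] ω) →ₗ[A] (M →ₗ[A] ω) :=
  LinearMap.lcomp A ω f

end delta

/-- The homology `ker g / im f` at the middle spot of `M → N → P`. -/
abbrev homMod (A : Type) [CommRing A] {M N P : Type} [AddCommGroup M] [Module A M]
    [AddCommGroup N] [Module A N] [AddCommGroup P] [Module A P]
    (f : M →ₗ[A] N) (g : N →ₗ[A] P) : Type :=
  ↥(LinearMap.ker g) ⧸ Submodule.comap (LinearMap.ker g).subtype (LinearMap.range f)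

end

namespace CMEnv

set_option linter.unusedSectionVars false

open scoped Pointwise
open Abelian.Ext (mk₀)
open IsLocalRing (maximalIdeal ResidueField)

/-- The shifted-degree Ext group in the sense of derived categories. -/
abbrev E (A : Type) [CommRing A] (i : ℕ) (M N : Type) [AddCommGroup M] [Module A M]
    [AddCommGroup N] [Module A N] : Type :=
  Abelian.Ext (ModuleCat.of A M) (ModuleCat.of A N) i

/-- Vanishing of `Ext^i_A(M, N)`. -/
def EV (A : Type) [CommRing A] (i : ℕ) (M N : Type) [AddCommGroup M] [Module A M]
    [AddCommGroup N] [Module A N] : Prop :=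
  Subsingleton (E A i M N)

section basic

variable {A : Type} [CommRing A] {M M' N N' Z : Type} [AddCommGroup M] [Module A M]
  [AddCommGroup M'] [Module A M'] [AddCommGroup N] [Module A N] [AddCommGroup N'] [Module A N']
  [AddCommGroup Z] [Module A Z]
  {M₁ M₂ M₃ : Type} [AddCommGroup M₁] [Module A M₁] [AddCommGroup M₂] [Module A M₂]
  [AddCommGroup M₃] [Module A M₃]

lemma EV_iff {i : ℕ} : EV A i M N ↔ ∀ x : E A i M N, x = 0 :=
  ⟨fun h x => h.elim x 0, fun h => ⟨fun x y => (h x).trans (h y).symm⟩⟩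

lemma EV_zero_iff : EV A 0 M N ↔ ∀ f : M →ₗ[A] N, f = 0 := by
  rw [EV_iff]
  constructor
  · intro h f
    have h1 := h (mk₀ (ModuleCat.ofHom f))
    rw [Abelian.Ext.mk₀_eq_zero_iff] at h1
    simpa using congrArg ModuleCat.Hom.hom h1
  · intro h x
    obtain ⟨f, rfl⟩ := Abelian.Ext.addEquiv₀.symm.surjective x
    have : f = 0 := by
      ext m
      simp [h f.hom]
    simp [this]

lemma EV.retract_left {i : ℕ} (h : EV A i M N) (s : M' →ₗ[A] M) (r : M →ₗ[A] M')
    (hrs : r ∘ₗ s = LinearMap.id) : EV A i M' N := by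
  rw [EV_iff] at *
  intro x
  have h1 : (mk₀ (ModuleCat.ofHom s)).comp ((mk₀ (ModuleCat.ofHom r)).comp x (zero_add i))
      (zero_add i) = x := by
    rw [Abelian.Ext.mk₀_comp_mk₀_assoc, ← ModuleCat.ofHom_comp, hrs, ModuleCat.ofHom_id,
      Abelian.Ext.mk₀_id_comp]
  rw [← h1, h ((mk₀ (ModuleCat.ofHom r)).comp x (zero_add i)), Abelian.Ext.comp_zero]

lemma EV.retract_right {i : ℕ} (h : EV A i M N) (s : N' →ₗ[A] N) (r : N →ₗ[A] N')
    (hrs : r ∘ₗ s = LinearMap.id) : EV A i M N' := by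
  rw [EV_iff] at *
  intro x
  have h1 : (x.comp (mk₀ (ModuleCat.ofHom s)) (add_zero i)).comp (mk₀ (ModuleCat.ofHom r))
      (add_zero i) = x := by
    rw [Abelian.Ext.comp_assoc_of_third_deg_zero, Abelian.Ext.mk₀_comp_mk₀,
      ← ModuleCat.ofHom_comp, hrs, ModuleCat.ofHom_id, Abelian.Ext.comp_mk₀_id]
  rw [← h1, h (x.comp (mk₀ (ModuleCat.ofHom s)) (add_zero i)), Abelian.Ext.zero_comp]

lemma EV.congr_left {i : ℕ} (h : EV A i M N) (e : M ≃ₗ[A] M') : EV A i M' N :=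
  h.retract_left e.symm.toLinearMap e.toLinearMap (by ext; simp)

lemma EV.congr_right {i : ℕ} (h : EV A i M N) (e : N ≃ₗ[A] N') : EV A i M N' :=
  h.retract_right e.symm.toLinearMap e.toLinearMap (by ext; simp)

lemma EV_of_subsingleton_right (i : ℕ) [Subsingleton N] : EV A i M N := by
  rw [EV_iff]
  intro x
  rw [← x.comp_mk₀_id]
  have : 𝟙 (ModuleCat.of A N) = 0 := by ext; exact Subsingleton.elim _ _
  rw [this]
  simp

lemma EV_of_subsingleton_left (i : ℕ) [Subsingleton M] : EV A i M N := by
  rw [EV_iff]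
  intro x
  rw [← x.mk₀_id_comp]
  have : 𝟙 (ModuleCat.of A M) = 0 := by ext; exact Subsingleton.elim _ _
  rw [this]
  simp

lemma EV_of_projective (i : ℕ) [Module.Projective A M] : EV A (i + 1) M N := by
  rw [EV_iff]
  intro x
  have : Projective (ModuleCat.of A M) := inferInstance
  exact x.eq_zero_of_projective

variable {f : M₁ →ₗ[A] M₂} {g : M₂ →ₗ[A] M₃}

lemma shortExact (hf : Function.Injective f) (hfg : Function.Exact f g)
    (hg : Function.Surjective g) :
    (ModuleCat.shortComplexOfCompEqZero f g hfg.linearMap_comp_eq_zero).ShortExact :=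
  ModuleCat.shortComplex_shortExact _ hfg hf hg

lemma EV.cov₂ (hf : Function.Injective f) (hfg : Function.Exact f g)
    (hg : Function.Surjective g) {i : ℕ} (h₁ : EV A i Z M₁) (h₃ : EV A i Z M₃) :
    EV A i Z M₂ := by
  rw [EV_iff] at *
  intro x
  obtain ⟨y, hy⟩ := Abelian.Ext.covariant_sequence_exact₂ _ (shortExact hf hfg hg) x (h₃ _)
  rw [← hy, h₁ y, Abelian.Ext.zero_comp]

lemma EV.cov₃ (hf : Function.Injective f) (hfg : Function.Exact f g)
    (hg : Function.Surjective g) {i : ℕ} (h₂ : EV A i Z M₂) (h₁ : EV A (i + 1) Z M₁) :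
    EV A i Z M₃ := by
  rw [EV_iff] at *
  intro x
  obtain ⟨y, hy⟩ := Abelian.Ext.covariant_sequence_exact₃ _ (shortExact hf hfg hg) x rfl (h₁ _)
  rw [← hy, h₂ y, Abelian.Ext.zero_comp]

lemma EV.cov₁ (hf : Function.Injective f) (hfg : Function.Exact f g)
    (hg : Function.Surjective g) {i : ℕ} (h₃ : EV A i Z M₃) (h₂ : EV A (i + 1) Z M₂) :
    EV A (i + 1) Z M₁ := by
  rw [EV_iff] at *
  intro x
  obtain ⟨y, hy⟩ := Abelian.Ext.covariant_sequence_exact₁ _ (shortExact hf hfg hg) x (h₂ _) rfl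
  rw [← hy, h₃ y, Abelian.Ext.zero_comp]

lemma EV.con₂ (hf : Function.Injective f) (hfg : Function.Exact f g)
    (hg : Function.Surjective g) {i : ℕ} (h₁ : EV A i M₁ N) (h₃ : EV A i M₃ N) :
    EV A i M₂ N := by
  rw [EV_iff] at *
  intro x
  obtain ⟨y, hy⟩ := Abelian.Ext.contravariant_sequence_exact₂ (shortExact hf hfg hg) _ x (h₁ _)
  rw [← hy, h₃ y, Abelian.Ext.comp_zero]

lemma EV.con₁ (hf : Function.Injective f) (hfg : Function.Exact f g)
    (hg : Function.Surjective g) {i : ℕ} (h₂ : EV A i M₂ N) (h₃ : EV A (i + 1) M₃ N) :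
    EV A i M₁ N := by
  rw [EV_iff] at *
  intro x
  obtain ⟨y, hy⟩ := Abelian.Ext.contravariant_sequence_exact₁ (shortExact hf hfg hg) _ x
    (add_comm 1 i) (h₃ _)
  rw [← hy, h₂ y, Abelian.Ext.comp_zero]

lemma EV.con₃ (hf : Function.Injective f) (hfg : Function.Exact f g)
    (hg : Function.Surjective g) {i : ℕ} (h₁ : EV A i M₁ N) (h₂ : EV A (i + 1) M₂ N) :
    EV A (i + 1) M₃ N := by
  rw [EV_iff] at *
  intro x
  obtain ⟨y, hy⟩ := Abelian.Ext.contravariant_sequence_exact₃ (shortExact hf hfg hg) _ x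
    (h₂ _) (add_comm 1 i)
  rw [← hy, h₁ y, Abelian.Ext.comp_zero]

lemma EV.exists_lift (hf : Function.Injective f) (hfg : Function.Exact f g)
    (hg : Function.Surjective g) (h₁ : EV A 1 Z M₁) (φ : Z →ₗ[A] M₃) :
    ∃ ψ : Z →ₗ[A] M₂, g ∘ₗ ψ = φ := by
  rw [EV_iff] at *
  obtain ⟨y, hy⟩ := Abelian.Ext.covariant_sequence_exact₃ _ (shortExact hf hfg hg)
    (mk₀ (ModuleCat.ofHom φ)) rfl (h₁ _)
  obtain ⟨y, rfl⟩ := Abelian.Ext.addEquiv₀.symm.surjective y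
  refine ⟨y.hom, ?_⟩
  have := (Abelian.Ext.mk₀_bijective _ _).1 ((Abelian.Ext.mk₀_comp_mk₀ _ _).symm.trans hy)
  exact congrArg ModuleCat.Hom.hom this

lemma EV.exists_extend (hf : Function.Injective f) (hfg : Function.Exact f g)
    (hg : Function.Surjective g) (h₃ : EV A 1 M₃ N) (φ : M₁ →ₗ[A] N) :
    ∃ ψ : M₂ →ₗ[A] N, ψ ∘ₗ f = φ := by
  rw [EV_iff] at *
  obtain ⟨y, hy⟩ := Abelian.Ext.contravariant_sequence_exact₁ (shortExact hf hfg hg) _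
    (mk₀ (ModuleCat.ofHom φ)) rfl (h₃ _)
  obtain ⟨y, rfl⟩ := Abelian.Ext.addEquiv₀.symm.surjective y
  refine ⟨y.hom, ?_⟩
  have := (Abelian.Ext.mk₀_bijective _ _).1 ((Abelian.Ext.mk₀_comp_mk₀ _ _).symm.trans hy)
  exact congrArg ModuleCat.Hom.hom this

lemma EV_one_of_extend (hf : Function.Injective f) (hfg : Function.Exact f g)
    (hg : Function.Surjective g) (hl : ∀ φ : M₁ →ₗ[A] N, ∃ ψ : M₂ →ₗ[A] N, ψ ∘ₗ f = φ)
    (h₂ : EV A 1 M₂ N) : EV A 1 M₃ N := by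
  rw [EV_iff] at *
  intro x
  obtain ⟨y, hy⟩ := Abelian.Ext.contravariant_sequence_exact₃ (shortExact hf hfg hg) _ x (h₂ _)
    (add_zero 1)
  obtain ⟨y, rfl⟩ := Abelian.Ext.addEquiv₀.symm.surjective y
  obtain ⟨ψ, hψ⟩ := hl y.hom
  have hy2 : y = (ModuleCat.shortComplexOfCompEqZero f g hfg.linearMap_comp_eq_zero).f ≫
      ModuleCat.ofHom ψ := by
    ext z
    simp [← hψ]
  rw [← hy, hy2]
  simp only [Abelian.Ext.addEquiv₀_symm_apply]
  rw [← Abelian.Ext.mk₀_comp_mk₀, ShortComplex.ShortExact.extClass_comp_assoc]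

end basic

section bridge

variable {A : Type} [CommRing A]

noncomputable def homologyEquiv (S : ShortComplex (ModuleCat.{0} A)) {W : Type} [AddCommGroup W]
    [Module A W]
    (θ : LinearMap.ker S.g.hom →ₗ[A] W) (hθ : Function.Surjective θ)
    (hk : LinearMap.ker θ = LinearMap.range S.moduleCatToCycles) : S.homology ≃ₗ[A] W :=
  S.moduleCatHomologyIso.toLinearEquiv ≪≫ₗ
    (Submodule.quotEquivOfEq _ _ hk.symm ≪≫ₗ θ.quotKerEquivOfSurjective hθ)

variable {X : ModuleCat.{0} A} (P : ProjectiveResolution X) (Y : ModuleCat.{0} A)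

lemma smul_extMk (n : ℕ) (r : A) (f : P.complex.X n ⟶ Y) (m : ℕ) (hm : n + 1 = m)
    (hf : P.complex.d m n ≫ f = 0) (hf' : P.complex.d m n ≫ (r • f) = 0) :
    P.extMk (r • f) m hm hf' = r • P.extMk f m hm hf := by
  rw [Abelian.Ext.smul_eq_comp_mk₀, P.extMk_comp_mk₀]
  congr 1

/-- The augmentation of a projective resolution. -/
noncomputable def augm : P.complex.X 0 ⟶ X := P.π.f 0

lemma d_augm : P.complex.d 1 0 ≫ augm P = 0 := P.complex_d_comp_π_f_zero

instance : Epi (augm P) := inferInstanceAs (Epi (P.π.f 0))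

noncomputable def cocycleToExt (n : ℕ) :
    LinearMap.ker (((P.complex.linearYonedaObj A Y).sc' (n - 1) n (n + 1)).g.hom) →ₗ[A]
      Abelian.Ext X Y n where
  toFun f := P.extMk f.1 (n + 1) rfl f.2
  map_add' f g := (P.add_extMk f.1 g.1 (n + 1) rfl f.2 g.2).symm
  map_smul' r f := smul_extMk P Y n r f.1 (n + 1) rfl f.2 (r • f).2

noncomputable def isoExtSucc (n : ℕ) : ((Ext A (ModuleCat.{0} A) (n + 1)).obj (Opposite.op X)).obj
    Y ≃ₗ[A]
    Abelian.Ext X Y (n + 1) :=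
  ((P.isoExt (R := A) (n + 1) Y) ≪≫ (P.complex.linearYonedaObj A Y).homologyIsoSc' n (n + 1)
    (n + 2) (by simp) (by simp)).toLinearEquiv ≪≫ₗ
    homologyEquiv _ (cocycleToExt P Y (n + 1))
    (fun x => by
      obtain ⟨f, hf, h⟩ := P.extMk_surjective x (n + 2) rfl
      exact ⟨⟨f, hf⟩, h⟩)
    (by
      ext ⟨f, hf⟩
      rw [LinearMap.mem_ker]
      refine (P.extMk_eq_zero_iff f (n + 2) rfl hf n rfl).trans ?_
      constructor
      · rintro ⟨g, hg⟩
        exact ⟨g, Subtype.ext hg⟩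
      · rintro ⟨g, hg⟩
        exact ⟨g, congrArg Subtype.val hg⟩)

noncomputable def homToCocycle : (X ⟶ Y) →ₗ[A]
    LinearMap.ker (((P.complex.linearYonedaObj A Y).sc' 0 0 1).g.hom) where
  toFun φ := ⟨(augm P ≫ φ : P.complex.X 0 ⟶ Y), by
    have : P.complex.d 1 0 ≫ (augm P ≫ φ) = 0 := by
      rw [← Category.assoc, d_augm, Limits.zero_comp]
    exact this⟩
  map_add' f g := by
    ext1
    exact Preadditive.comp_add _ _ _ _ _ _
  map_smul' r f := by
    ext1
    exact Linear.comp_smul _ _ _ _ _ _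

lemma homToCocycle_bijective : Function.Bijective (homToCocycle P Y) := by
  constructor
  · intro f g h
    have h1 : augm P ≫ f = augm P ≫ g := congrArg Subtype.val h
    exact (cancel_epi _).1 h1
  · rintro ⟨f, hf⟩
    have hf' : P.complex.d 1 0 ≫ f = 0 := hf
    have : Epi (ShortComplex.mk _ _ P.complex_d_comp_π_f_zero).g :=
      inferInstanceAs (Epi (augm P))
    refine ⟨P.exact₀.desc f hf', Subtype.ext ?_⟩
    exact P.exact₀.g_desc f hf'

noncomputable def isoExtZero : ((Ext A (ModuleCat.{0} A) 0).obj (Opposite.op X)).obj Y ≃ₗ[A]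
    Abelian.Ext X Y 0 :=
  ((P.isoExt (R := A) 0 Y) ≪≫ (P.complex.linearYonedaObj A Y).homologyIsoSc' 0 0
    1 (by simp) (by simp)).toLinearEquiv ≪≫ₗ
    homologyEquiv _ (Abelian.Ext.linearEquiv₀.symm.toLinearMap ∘ₗ
      (LinearEquiv.ofBijective _ (homToCocycle_bijective P Y)).symm.toLinearMap)
    (by
      rw [← LinearEquiv.coe_trans]
      exact LinearEquiv.surjective _)
    (by
      rw [← LinearEquiv.coe_trans, LinearEquiv.ker, eq_comm, LinearMap.range_eq_bot]
      ext1 f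
      apply Subtype.ext
      change (P.complex.linearYonedaObj A Y).d 0 0 f = 0
      rw [HomologicalComplex.shape _ _ _ (by simp)]
      rfl)

end bridge

variable {A : Type} [CommRing A] (M N : Type) [AddCommGroup M] [Module A M]
    [AddCommGroup N] [Module A N]

noncomputable def ext1Equiv (n : ℕ) : ext1 A n M N ≃ₗ[A] E A n M N :=
  match n with
  | 0 => isoExtZero (ProjectiveResolution.of (ModuleCat.of A M)) _
  | n + 1 => isoExtSucc (ProjectiveResolution.of (ModuleCat.of A M)) _ n

variable {M N} in
lemma ext1_subsingleton_iff {n : ℕ} : Subsingleton (ext1 A n M N) ↔ EV A n M N :=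
  (ext1Equiv M N n).toEquiv.subsingleton_congr

/-- `depth N ≥ j`, in terms of vanishing of Ext. -/
def depthGE (A : Type) [CommRing A] [IsLocalRing A] (j : ℕ) (N : Type) [AddCommGroup N]
    [Module A N] : Prop :=
  ∀ i < j, EV A i (IsLocalRing.ResidueField A) N

variable {N} in
lemma le_rdepth_iff [IsLocalRing A] {j : ℕ} : (j : ℕ∞) ≤ rdepth A N ↔ depthGE A j N := by
  unfold rdepth depthGE
  rw [le_sInf_iff]
  simp only [Set.mem_ofPred_eq, forall_exists_index, and_imp, ext1_subsingleton_iff]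
  constructor
  · intro h i hi
    by_contra hc
    exact absurd (h i i rfl hc) (by simpa using hi)
  · rintro h _ m rfl hm
    by_contra hc
    exact hm (h m (by simpa using hc))

section sesHelpers

variable {A : Type} [CommRing A] {M N : Type} [AddCommGroup M] [Module A M]
    [AddCommGroup N] [Module A N]

lemma exact_lsmul_mkQ (x : A) :
    Function.Exact (LinearMap.lsmul A M x) (Submodule.mkQ (x • (⊤ : Submodule A M))) := by
  intro m
  simp [Submodule.mem_smul_pointwise_iff_exists]

lemma exact_ker_subtype (g : M →ₗ[A] N) : Function.Exact (LinearMap.ker g).subtype g := by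
  intro m; simp

lemma exact_subtype_mkQ (p : Submodule A M) : Function.Exact p.subtype p.mkQ := by
  intro m; simp

lemma E_comp_lsmul {i : ℕ} (x : E A i M N) (r : A) :
    x.comp (mk₀ (ModuleCat.ofHom (LinearMap.lsmul A N r))) (add_zero i) = r • x := by
  have : ModuleCat.ofHom (LinearMap.lsmul A N r) = r • 𝟙 (ModuleCat.of A N) := by
    ext; simp
  rw [this, Abelian.Ext.smul_eq_comp_mk₀]

lemma E_lsmul_comp {i : ℕ} (x : E A i M N) (r : A) :
    (mk₀ (ModuleCat.ofHom (LinearMap.lsmul A M r))).comp x (zero_add i) = r • x := by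
  have : ModuleCat.ofHom (LinearMap.lsmul A M r) = r • 𝟙 (ModuleCat.of A M) := by
    ext; simp
  rw [this, Abelian.Ext.mk₀_smul, Abelian.Ext.smul_comp, Abelian.Ext.mk₀_id_comp]

end sesHelpers

section local_

variable {A : Type} [CommRing A] [IsNoetherianRing A] [IsLocalRing A]

lemma subsingleton_of_smul_surj {P : Type} [AddCommGroup P] [Module A P] [Module.Finite A P]
    {x : A} (hx : x ∈ maximalIdeal A) (h : ∀ p : P, ∃ q, x • q = p) : Subsingleton P := by
  have h1 : (⊤ : Submodule A P) ≤ Ideal.span {x} • (⊤ : Submodule A P) := by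
    intro p _
    obtain ⟨q, rfl⟩ := h p
    exact Submodule.smul_mem_smul (Ideal.mem_span_singleton_self x) trivial
  have h2 := Submodule.eq_bot_of_le_smul_of_le_jacobson_bot (Ideal.span {x}) (⊤ : Submodule A P)
    Module.Finite.fg_top h1 (by
      rw [IsLocalRing.jacobson_eq_maximalIdeal _ bot_ne_top]
      simpa [Ideal.span_le] using hx)
  exact (Submodule.subsingleton_iff A).1 (subsingleton_of_bot_eq_top h2.symm)

variable {M N : Type} [AddCommGroup M] [Module A M] [AddCommGroup N] [Module A N]
  [Module.Finite A M] [Module.Finite A N]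

lemma EV.of_smul_left {x : A} (hx : x ∈ maximalIdeal A) (hr : IsSMulRegular M x) {i : ℕ}
    (h : EV A (i + 1) (QuotSMulTop x M) N) : EV A i M N := by
  refine subsingleton_of_smul_surj hx fun p => ?_
  obtain ⟨q, hq⟩ := Abelian.Ext.contravariant_sequence_exact₁
    (shortExact (f := LinearMap.lsmul A M x) hr (exact_lsmul_mkQ x) (Submodule.mkQ_surjective _))
    (ModuleCat.of A N) p (add_comm 1 i) ((EV_iff.1 h) _)
  exact ⟨q, (E_lsmul_comp q x).symm.trans hq⟩

lemma withBot_le_of_succ {a : WithBot ℕ∞} {n : ℕ} (h : a + 1 ≤ ((n + 1 : ℕ) : WithBot ℕ∞)) :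
    a ≤ (n : WithBot ℕ∞) := by
  induction a with
  | bot => exact bot_le
  | coe a =>
    induction a with
    | top =>
      have h' : ((⊤ : ℕ∞) : WithBot ℕ∞) ≤ ((n + 1 : ℕ) : ℕ∞) := h
      rw [WithBot.coe_le_coe] at h'
      exact absurd h' (by simp)
    | coe a =>
      norm_cast at *
      omega

lemma residue_equiv : Nonempty ((A ⧸ maximalIdeal A) ≃ₗ[A] ResidueField A) :=
  ⟨LinearEquiv.refl A (A ⧸ maximalIdeal A)⟩

lemma isSMulRegular_of_equiv_quot {P : PrimeSpectrum A} (e : N ≃ₗ[A] A ⧸ P.1) {x : A}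
    (hx : x ∉ P.1) : IsSMulRegular N x := by
  rw [e.isSMulRegular_congr]
  refine isSMulRegular_iff_right_eq_zero_of_smul.2 fun m hm => ?_
  obtain ⟨m, rfl⟩ := Ideal.Quotient.mk_surjective m
  rw [← Ideal.Quotient.mk_eq_mk, ← Submodule.Quotient.mk_smul, Ideal.Quotient.mk_eq_mk,
    Ideal.Quotient.eq_zero_iff_mem] at hm
  exact Ideal.Quotient.eq_zero_iff_mem.2 ((P.2.mem_or_mem hm).resolve_left hx)

open Module (supportDim)

lemma supportDim_quotSMulTop_le {x : A} (hx : x ∈ maximalIdeal A) (hr : IsSMulRegular N x) {n : ℕ}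
    (h : supportDim A N ≤ (n + 1 : ℕ)) : supportDim A (QuotSMulTop x N) ≤ n :=
  withBot_le_of_succ ((Module.supportDim_quotSMulTop_succ_eq_supportDim hr hx).le.trans h)

/-- Ischebeck's theorem. -/
lemma ischebeck {r : ℕ} (hM : depthGE A r M) (n : ℕ) : ∀ (N : Type) [AddCommGroup N]
    [Module A N] [Module.Finite A N], supportDim A N ≤ n → ∀ i, i + n < r → EV A i N M := by
  induction n with
  | zero =>
    intro N _ _ hN
    refine IsNoetherianRing.induction_on_isQuotientEquivQuotientPrime A hN
      (motive := fun N _ _ _ => supportDim A N ≤ (0 : ℕ) → ∀ i, i + 0 < r → EV A i N M)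
      ?_ ?_ ?_
    · intro N _ _ _ _ _ i _
      exact EV_of_subsingleton_left i
    · intro N _ _ _ P e hd i hi
      by_cases hP : P.1 = maximalIdeal A
      · have := hM i hi
        rw [hP] at e
        exact this.congr_left (residue_equiv.some.symm.trans e.symm)
      · obtain ⟨x, hx, hxP⟩ : ∃ x ∈ maximalIdeal A, x ∉ P.1 := by
          by_contra hc
          push Not at hc
          exact hP (le_antisymm (IsLocalRing.le_maximalIdeal P.2.ne_top) hc)
        have hr := isSMulRegular_of_equiv_quot e hxP
        have h1 := Module.supportDim_quotSMulTop_succ_eq_supportDim hr hx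
        rw [← h1] at hd
        have hnt : Nontrivial N := e.toEquiv.nontrivial
        have : Nontrivial (QuotSMulTop x N) := by
          by_contra hc
          rw [not_nontrivial_iff_subsingleton] at hc
          have := Module.supportDim_eq_bot_of_subsingleton (R := A) (M := QuotSMulTop x N)
          rw [this, WithBot.bot_add, eq_comm, Module.supportDim_eq_bot_iff_subsingleton] at h1
          exact not_subsingleton _ h1
        have h2 := Module.supportDim_ne_bot_of_nontrivial A (QuotSMulTop x N)
        obtain ⟨a, ha⟩ := WithBot.ne_bot_iff_exists.1 h2
        rw [← ha] at hd
        exfalso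
        norm_cast at hd
        simp at hd
    · intro N₁ _ _ _ N₂ _ _ _ N₃ _ _ _ f g hf hg hfg h1 h3 hd i hi
      exact EV.con₂ hf hfg hg (h1 ((Module.supportDim_le_of_injective f hf).trans hd) i hi)
        (h3 ((Module.supportDim_le_of_surjective g hg).trans hd) i hi)
  | succ n ih =>
    intro N _ _ hN
    refine IsNoetherianRing.induction_on_isQuotientEquivQuotientPrime A hN
      (motive := fun N _ _ _ => supportDim A N ≤ (n + 1 : ℕ) → ∀ i, i + (n + 1) < r → EV A i N M)
      ?_ ?_ ?_
    · intro N _ _ _ _ _ i _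
      exact EV_of_subsingleton_left i
    · intro N _ _ _ P e hd i hi
      by_cases hP : P.1 = maximalIdeal A
      · have := hM i (by omega)
        rw [hP] at e
        exact this.congr_left (residue_equiv.some.symm.trans e.symm)
      · obtain ⟨x, hx, hxP⟩ : ∃ x ∈ maximalIdeal A, x ∉ P.1 := by
          by_contra hc
          push Not at hc
          exact hP (le_antisymm (IsLocalRing.le_maximalIdeal P.2.ne_top) hc)
        have hr := isSMulRegular_of_equiv_quot e hxP
        exact EV.of_smul_left hx hr (ih _ (supportDim_quotSMulTop_le hx hr hd) (i + 1) (by omega))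
    · intro N₁ _ _ _ N₂ _ _ _ N₃ _ _ _ f g hf hg hfg h1 h3 hd i hi
      exact EV.con₂ hf hfg hg (h1 ((Module.supportDim_le_of_injective f hf).trans hd) i hi)
        (h3 ((Module.supportDim_le_of_surjective g hg).trans hd) i hi)

lemma EV_of_codGT {d n : ℕ} (hM : depthGE A d M) (hN : codGT A d N n) {i : ℕ} (hi : i ≤ n) :
    EV A i N M := by
  unfold codGT mdim at hN
  rw [← Module.supportDim_eq_ringKrullDim_quotient_annihilator] at hN
  rcases subsingleton_or_nontrivial N with hs | hs
  · exact EV_of_subsingleton_left i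
  obtain ⟨a, ha⟩ := WithBot.ne_bot_iff_exists.1 (Module.supportDim_ne_bot_of_nontrivial A N)
  rw [← ha] at hN
  have : ∃ m : ℕ, (m : ℕ∞) = a := by
    induction a with
    | top => exact absurd hN (by
        rw [not_lt]; exact le_of_le_of_eq le_top rfl)
    | coe a => exact ⟨a, rfl⟩
  obtain ⟨m, rfl⟩ := this
  refine ischebeck hM m N ha.symm.le i ?_
  norm_cast at hN
  omega

lemma depthGE_le_supportDim {r : ℕ} (hM : depthGE A r M) [Nontrivial M] :
    (r : WithBot ℕ∞) ≤ supportDim A M := by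
  by_contra hc
  rw [not_le] at hc
  obtain ⟨a, ha⟩ := WithBot.ne_bot_iff_exists.1 (Module.supportDim_ne_bot_of_nontrivial A M)
  rw [← ha] at hc
  have : ∃ m : ℕ, (m : ℕ∞) = a := by
    induction a with
    | top => exact absurd hc (by
        rw [not_lt]; exact le_of_le_of_eq le_top rfl)
    | coe a => exact ⟨a, rfl⟩
  obtain ⟨m, rfl⟩ := this
  have := ischebeck hM m M ha.symm.le 0 (by norm_cast at hc; omega)
  rw [EV_zero_iff] at this
  obtain ⟨y, hy⟩ := exists_ne (0 : M)
  exact hy (congrArg (fun f => f y) (this LinearMap.id))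

end local_

section depth

variable {A : Type} [CommRing A] [IsLocalRing A]

lemma depthGE.mono {N : Type} [AddCommGroup N] [Module A N] {j j' : ℕ} (h : depthGE A j N)
    (hj : j' ≤ j) : depthGE A j' N :=
  fun i hi => h i (hi.trans_le hj)

lemma depthGE.congr {N N' : Type} [AddCommGroup N] [Module A N] [AddCommGroup N'] [Module A N']
    {j : ℕ} (h : depthGE A j N) (e : N ≃ₗ[A] N') : depthGE A j N' :=
  fun i hi => (h i hi).congr_right e

end depth

section bass

variable {A : Type} [CommRing A] [IsNoetherianRing A] [IsLocalRing A]
variable {M N : Type} [AddCommGroup M] [Module A M] [AddCommGroup N] [Module A N]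
  [Module.Finite A M] [Module.Finite A N]

instance finite_residueField : Module.Finite A (ResidueField A) :=
  Module.Finite.equiv (residue_equiv (A := A)).some

lemma residueField_smul {x : A} (hx : x ∈ maximalIdeal A) (y : ResidueField A) : x • y = 0 := by
  rw [Algebra.smul_def, IsLocalRing.ResidueField.algebraMap_eq,
    (IsLocalRing.residue_eq_zero_iff x).2 hx, zero_mul]

lemma mem_maximalIdeal_of_ann {x : A} (hx : x ∈ Module.annihilator A (ResidueField A)) :
    x ∈ maximalIdeal A := by
  rw [Module.mem_annihilator] at hx
  have := hx 1
  rwa [Algebra.smul_def, mul_one, IsLocalRing.ResidueField.algebraMap_eq,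
    IsLocalRing.residue_eq_zero_iff] at this

lemma exists_regular {j : ℕ} (h : depthGE A (j + 1) N) :
    ∃ x ∈ maximalIdeal A, IsSMulRegular N x := by
  have h0 := EV_zero_iff.1 (h 0 (by omega))
  have : Subsingleton (ResidueField A →ₗ[A] N) := ⟨fun f g => (h0 f).trans (h0 g).symm⟩
  obtain ⟨x, hx, hr⟩ := IsSMulRegular.subsingleton_linearMap_iff.1 this
  exact ⟨x, mem_maximalIdeal_of_ann hx, hr⟩

lemma depthGE.quot {j : ℕ} (h : depthGE A (j + 1) N) {x : A} (hr : IsSMulRegular N x) :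
    depthGE A j (QuotSMulTop x N) := fun i hi =>
  EV.cov₃ (f := LinearMap.lsmul A N x) hr (exact_lsmul_mkQ x) (Submodule.mkQ_surjective _)
    (h i (by omega)) (h (i + 1) (by omega))

lemma EV.succ_of_quot {x : A} (hx : ∀ m : M, x • m = 0) (hr : IsSMulRegular N x) {i : ℕ}
    (h : EV A i M (QuotSMulTop x N)) : EV A (i + 1) M N := by
  rw [EV_iff] at *
  intro p
  obtain ⟨y, hy⟩ := Abelian.Ext.covariant_sequence_exact₁ (ModuleCat.of A M)
    (shortExact (f := LinearMap.lsmul A N x) hr (exact_lsmul_mkQ x) (Submodule.mkQ_surjective _)) p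
    ((E_comp_lsmul p x).trans (by
      rw [← E_lsmul_comp]
      have : ModuleCat.ofHom (LinearMap.lsmul A M x) = 0 := by ext m; exact hx m
      rw [this, Abelian.Ext.mk₀_zero, Abelian.Ext.zero_comp])) rfl
  rw [← hy, h y, Abelian.Ext.zero_comp]

/-- Vanishing of `Ext^m(N, Y)` for all finitely generated `N` and all `m > n`. -/
def EVbound (A : Type) [CommRing A] (n : ℕ) (Y : Type) [AddCommGroup Y] [Module A Y] : Prop :=
  ∀ (N : Type) [AddCommGroup N] [Module A N] [Module.Finite A N], ∀ m, n < m → EV A m N Y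

variable {Y : Type} [AddCommGroup Y] [Module A Y] [Module.Finite A Y]

lemma EVbound.nv {n : ℕ} (hY : EVbound A n Y) : ∀ (j : ℕ) (N : Type) [AddCommGroup N] [Module A N]
    [Module.Finite A N], depthGE A j N → ∀ m, n < m + j → EV A m N Y := by
  intro j
  induction j with
  | zero => intro N _ _ _ _ m hm; exact hY N m hm
  | succ j ih =>
    intro N _ _ _ hN m hm
    obtain ⟨x, hx, hr⟩ := exists_regular hN
    exact EV.of_smul_left hx hr (ih _ (hN.quot hr) (m + 1) (by omega))

lemma EV_of_residue {n : ℕ} (hY : EVbound A n Y) (hk : EV A n (ResidueField A) Y) (N : Type)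
    [AddCommGroup N] [Module A N] [hN : Module.Finite A N] : EV A n N Y := by
  refine IsNoetherianRing.induction_on_isQuotientEquivQuotientPrime A hN
    (motive := fun N _ _ _ => EV A n N Y) ?_ ?_ ?_
  · intro N _ _ _ _
    exact EV_of_subsingleton_left n
  · intro N _ _ _ P e
    by_cases hP : P.1 = maximalIdeal A
    · rw [hP] at e
      exact hk.congr_left (residue_equiv.some.symm.trans e.symm)
    · obtain ⟨x, hx, hxP⟩ : ∃ x ∈ maximalIdeal A, x ∉ P.1 := by
        by_contra hc
        push Not at hc
        exact hP (le_antisymm (IsLocalRing.le_maximalIdeal P.2.ne_top) hc)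
      exact EV.of_smul_left hx (isSMulRegular_of_equiv_quot e hxP) (hY _ _ (by omega))
  · intro N₁ _ _ _ N₂ _ _ _ N₃ _ _ _ f g hf hg hfg h1 h3
    exact EV.con₂ hf hfg hg h1 h3

lemma not_EV_of_depth {n : ℕ} (hY : EVbound A n Y) (hk : ¬ EV A n (ResidueField A) Y) (j : ℕ) :
    ∀ (N : Type) [AddCommGroup N] [Module A N] [Module.Finite A N], depthGE A j N →
      ¬ EV A j (ResidueField A) N → ∀ t, t + j = n → ¬ EV A t N Y := by
  induction j with
  | zero =>
    intro N _ _ _ _ h0 t ht hEV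
    rw [EV_zero_iff] at h0
    push Not at h0
    obtain ⟨f, hf⟩ := h0
    obtain rfl : t = n := by omega
    refine hk (EV.con₁ (f := f) (g := (LinearMap.range f).mkQ) ?_ ?_ (Submodule.mkQ_surjective _)
      hEV (hY _ _ (by omega)))
    · rw [injective_iff_map_eq_zero]
      intro a ha
      by_contra hne
      apply hf
      refine LinearMap.ext fun y => ?_
      obtain ⟨b, hb⟩ := IsLocalRing.residue_surjective (y * a⁻¹)
      have h1 : y = b • a := by
        rw [Algebra.smul_def, IsLocalRing.ResidueField.algebraMap_eq, hb, mul_assoc,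
          inv_mul_cancel₀ hne, mul_one]
      rw [h1, map_smul, ha, smul_zero, LinearMap.zero_apply]
    · exact LinearMap.exact_map_mkQ_range f
  | succ j ih =>
    intro N _ _ _ hN hne t ht hEV
    obtain ⟨x, hx, hr⟩ := exists_regular hN
    refine ih (QuotSMulTop x N) (hN.quot hr) (fun h => hne ?_) (t + 1) (by omega) ?_
    · exact EV.succ_of_quot (residueField_smul hx) hr h
    · exact EV.con₃ (f := LinearMap.lsmul A N x) hr (exact_lsmul_mkQ x)
        (Submodule.mkQ_surjective _) hEV (hY.nv (j + 1) N hN (t + 1) (by omega))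

/-- Bass's theorem on the injective dimension. -/
lemma EVbound.bass {n h : ℕ} (hY : EVbound A n Y) (hh : ringKrullDim A ≤ h) : EVbound A h Y := by
  classical
  have hex : ∃ n, EVbound A n Y := ⟨n, hY⟩
  have hn := Nat.find_spec hex
  have hmin := fun m (hm : m < Nat.find hex) => Nat.find_min hex hm
  set n := Nat.find hex
  by_cases hnh : n ≤ h
  · intro N _ _ _ m hm
    exact hn N m (by omega)
  exfalso
  have hk : ¬ EV A n (ResidueField A) Y := by
    intro hk
    refine hmin (n - 1) (by omega) ?_
    intro N _ _ _ m hm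
    rcases Nat.lt_or_ge n m with h1 | h1
    · exact hn N m h1
    · obtain rfl : m = n := by omega
      exact EV_of_residue hn hk N
  have hd : ¬ depthGE A (h + 1) A := by
    intro hd
    have := (depthGE_le_supportDim hd).trans
      ((Module.supportDim_self_eq_ringKrullDim (R := A)).le.trans hh)
    norm_cast at this
    omega
  have hexi : ∃ i, ¬ EV A i (ResidueField A) A := by
    by_contra hc
    push Not at hc
    exact hd fun i _ => hc i
  have hi1 := Nat.find_spec hexi
  have hi2 : depthGE A (Nat.find hexi) A := fun i hi => not_not.1 (Nat.find_min hexi hi)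
  set i := Nat.find hexi
  have hih : i ≤ h := by
    by_contra hc
    exact hd (hi2.mono (by omega))
  have h1 := not_EV_of_depth hn hk i A hi2 hi1 (n - i) (by omega)
  apply h1
  obtain ⟨t, ht⟩ : ∃ t, n - i = t + 1 := ⟨n - i - 1, by omega⟩
  rw [ht]
  exact EV_of_projective t

end bass

section desc

variable {A : Type} [CommRing A] {M N V : Type} [AddCommGroup M] [Module A M] [AddCommGroup N]
  [Module A N] [AddCommGroup V] [Module A V]

/-- Factor a map through a surjection. -/
noncomputable def desc (q : M →ₗ[A] N) (hq : Function.Surjective q) (f : M →ₗ[A] V)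
    (h : ∀ m, q m = 0 → f m = 0) : N →ₗ[A] V :=
  (LinearMap.ker q).liftQ f (fun m hm => h m hm) ∘ₗ (q.quotKerEquivOfSurjective hq).symm.toLinearMap

@[simp]
lemma desc_apply (q : M →ₗ[A] N) (hq : Function.Surjective q) (f : M →ₗ[A] V)
    (h : ∀ m, q m = 0 → f m = 0) (m : M) : desc q hq f h (q m) = f m := by
  have : (q.quotKerEquivOfSurjective hq).symm (q m) = (LinearMap.ker q).mkQ m := by
    rw [LinearEquiv.symm_apply_eq]; rfl
  rw [desc, LinearMap.comp_apply, LinearEquiv.coe_coe, this]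
  exact Submodule.liftQ_apply _ _ _

lemma EV.prod_right {N' : Type} [AddCommGroup N'] [Module A N'] {i : ℕ} (h : EV A i M N)
    (h' : EV A i M N') :
    EV A i M (N × N') :=
  EV.cov₂ (f := LinearMap.inl A N N') (g := LinearMap.snd A N N') LinearMap.inl_injective
    Function.Exact.inl_snd LinearMap.snd_surjective h h'

end desc

section endCanonical

variable {A : Type} [CommRing A] [IsNoetherianRing A] [IsLocalRing A]

lemma length_quot_prime_eq_top {L : Type} [AddCommGroup L] [Module A L] [Module.Finite A L]
    (P : PrimeSpectrum A) (e : L ≃ₗ[A] A ⧸ P.1) (hP : P.1 ≠ maximalIdeal A) :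
    Module.length A L = ⊤ := by
  obtain ⟨x, hx, hxP⟩ : ∃ x ∈ maximalIdeal A, x ∉ P.1 := by
    by_contra hc
    push Not at hc
    exact hP (le_antisymm (IsLocalRing.le_maximalIdeal P.2.ne_top) hc)
  by_contra hne
  obtain ⟨_, h2⟩ := isFiniteLength_iff_isNoetherian_isArtinian.1 (Module.length_ne_top_iff.1 hne)
  have hs := IsArtinian.surjective_of_injective_endomorphism (LinearMap.lsmul A L x)
    (isSMulRegular_of_equiv_quot e hxP)
  have h3 : Subsingleton L := subsingleton_of_smul_surj hx fun y => hs y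
  have h4 : Subsingleton (A ⧸ P.1) := e.symm.toEquiv.subsingleton
  exact P.2.ne_top (Ideal.Quotient.subsingleton_iff.1 h4)

lemma length_ne_top_of_supportDim (L : Type) [AddCommGroup L] [Module A L]
    [hL : Module.Finite A L] :
    Module.supportDim A L ≤ 0 → Module.length A L ≠ ⊤ := by
  refine IsNoetherianRing.induction_on_isQuotientEquivQuotientPrime A hL
    (motive := fun L _ _ _ => Module.supportDim A L ≤ 0 → Module.length A L ≠ ⊤) ?_ ?_ ?_
  · intro N _ _ _ _ _
    rw [Module.length_eq_zero]
    simp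
  · intro N _ _ _ P e hd
    by_cases hP : P.1 = maximalIdeal A
    · rw [hP] at e
      have : IsSimpleModule A (A ⧸ maximalIdeal A) :=
        isSimpleModule_iff_isCoatom.2 (IsLocalRing.maximalIdeal.isMaximal A).out
      have : IsSimpleModule A N := IsSimpleModule.congr e
      rw [Module.length_eq_one]
      simp
    · exfalso
      obtain ⟨x, hx, hxP⟩ : ∃ x ∈ maximalIdeal A, x ∉ P.1 := by
        by_contra hc
        push Not at hc
        exact hP (le_antisymm (IsLocalRing.le_maximalIdeal P.2.ne_top) hc)
      have hr := isSMulRegular_of_equiv_quot e hxP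
      have : Nontrivial N := by
        have := Ideal.Quotient.nontrivial_iff.2 P.2.ne_top
        exact e.toEquiv.nontrivial
      have h1 : depthGE A 1 N := by
        intro i hi
        obtain rfl : i = 0 := by omega
        rw [EV_zero_iff]
        intro f
        refine LinearMap.ext fun y => hr ?_
        simp only [LinearMap.zero_apply, smul_zero]
        rw [← map_smul, residueField_smul hx, map_zero]
      have h2 := (depthGE_le_supportDim h1).trans hd
      norm_num at h2
  · intro N₁ _ _ _ N₂ _ _ _ N₃ _ _ _ f g hf hg hfg h1 h3 hd
    rw [Module.length_eq_add_of_exact f g hf hg hfg]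
    exact WithTop.add_ne_top.2 ⟨h1 ((Module.supportDim_le_of_injective f hf).trans hd),
      h3 ((Module.supportDim_le_of_surjective g hg).trans hd)⟩

lemma length_hom_le {V : Type} [AddCommGroup V] [Module A V]
    (τ : (ResidueField A →ₗ[A] V) →ₗ[A] ResidueField A)
    (hτ : Function.Injective τ) (L : Type) [AddCommGroup L] [Module A L] [hL : Module.Finite A L] :
    Module.length A (L →ₗ[A] V) ≤ Module.length A L := by
  refine IsNoetherianRing.induction_on_isQuotientEquivQuotientPrime A hL
    (motive := fun L _ _ _ => Module.length A (L →ₗ[A] V) ≤ Module.length A L) ?_ ?_ ?_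
  · intro N _ _ _ _
    have : Subsingleton (N →ₗ[A] V) := inferInstance
    rw [Module.length_eq_zero]
    exact bot_le
  · intro N _ _ _ P e
    by_cases hP : P.1 = maximalIdeal A
    · rw [hP] at e
      have e' : N ≃ₗ[A] ResidueField A := e.trans residue_equiv.some
      rw [e'.length_eq, (LinearEquiv.congrLeft V A e').length_eq]
      exact Module.length_le_of_injective τ hτ
    · rw [length_quot_prime_eq_top P e hP]
      exact le_top
  · intro N₁ _ _ _ N₂ _ _ _ N₃ _ _ _ f g hf hg hfg h1 h3
    rw [Module.length_eq_add_of_exact f g hf hg hfg]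
    have hex : Function.Exact (LinearMap.lcomp A V g) (LinearMap.lcomp A V f) :=
      LinearMap.exact_lcomp_of_exact_of_surjective V hfg hg
    have h4 := Module.length_eq_add_of_exact (LinearMap.lcomp A V g)
      (LinearMap.lcomp A V f).rangeRestrict (LinearMap.lcomp_injective_of_surjective g hg)
      (LinearMap.surjective_rangeRestrict _) (by
        intro y
        rw [← hex y]
        exact ⟨fun h => congrArg Subtype.val h, fun h => Subtype.ext h⟩)
    rw [h4, add_comm]
    exact add_le_add ((Module.length_le_of_injective (LinearMap.range _).subtype
      Subtype.val_injective).trans h1) h3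

lemma exists_regular₂ {N V : Type} [AddCommGroup N] [Module A N] [AddCommGroup V] [Module A V]
    [Module.Finite A N] [Module.Finite A V] {j : ℕ} (hN : depthGE A (j + 1) N)
    (hV : depthGE A (j + 1) V) :
    ∃ x ∈ maximalIdeal A, IsSMulRegular N x ∧ IsSMulRegular V x := by
  obtain ⟨x, hx, hr⟩ := exists_regular (N := N × V) (j := j) fun i hi =>
      (hN i hi).prod_right (hV i hi)
  refine ⟨x, hx, fun a b h => ?_, fun a b h => ?_⟩
  · exact congrArg Prod.fst (hr (Prod.ext h rfl : x • (a, (0 : V)) = x • (b, (0 : V))))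
  · exact congrArg Prod.snd (hr (Prod.ext rfl h : x • ((0 : N), a) = x • ((0 : N), b)))

variable {ω : Type} [AddCommGroup ω] [Module A ω] [Module.Finite A ω]

/-- The connecting map `Ext^j(M₁, ω) → Ext^{j+1}(M₃, ω)`. -/
noncomputable def connL {M₁ M₂ M₃ : Type} [AddCommGroup M₁] [Module A M₁] [AddCommGroup M₂]
    [Module A M₂] [AddCommGroup M₃] [Module A M₃] {f : M₁ →ₗ[A] M₂} {g : M₂ →ₗ[A] M₃}
    (hf : Function.Injective f) (hfg : Function.Exact f g) (hg : Function.Surjective g) (j : ℕ)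
    (W : Type) [AddCommGroup W] [Module A W] :
    E A j M₁ W →ₗ[A] E A (j + 1) M₃ W where
  toFun x := (shortExact hf hfg hg).extClass.comp x (add_comm 1 j)
  map_add' x y := by simp
  map_smul' r x := by simp

noncomputable def connR {M₁ M₂ M₃ : Type} [AddCommGroup M₁] [Module A M₁] [AddCommGroup M₂]
    [Module A M₂] [AddCommGroup M₃] [Module A M₃] {f : M₁ →ₗ[A] M₂} {g : M₂ →ₗ[A] M₃}
    (hf : Function.Injective f) (hfg : Function.Exact f g) (hg : Function.Surjective g) (j : ℕ)
    (W : Type) [AddCommGroup W] [Module A W] :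
    E A j W M₃ →ₗ[A] E A (j + 1) W M₁ where
  toFun x := x.comp (shortExact hf hfg hg).extClass rfl
  map_add' x y := by simp
  map_smul' r x := by simp

lemma lift_pi_injective {d : ℕ} (hωd : depthGE A d ω) {N L : Type} [AddCommGroup N] [Module A N]
    [AddCommGroup L] [Module A L] [Module.Finite A N] [Module.Finite A L]
    (hdim : Module.supportDim A N ≤ 0) (g : N →ₗ[A] L) (hg : Function.Surjective g)
    (x : E A d L ω) (hx : (mk₀ (ModuleCat.ofHom g)).comp x (zero_add d) = 0) : x = 0 := by
  rcases d with _ | d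
  · obtain ⟨φ, rfl⟩ := (Abelian.Ext.mk₀_bijective _ _).2 x
    rw [Abelian.Ext.mk₀_comp_mk₀] at hx
    have : Epi (ModuleCat.ofHom g) := (ModuleCat.epi_iff_surjective _).2 hg
    have h1 := (Abelian.Ext.mk₀_eq_zero_iff _).1 hx
    rw [Limits.zero_of_epi_comp _ h1, Abelian.Ext.mk₀_zero]
  · obtain ⟨y, hy⟩ := Abelian.Ext.contravariant_sequence_exact₃
      (shortExact (f := (LinearMap.ker g).subtype) Subtype.val_injective (exact_ker_subtype g) hg)
      (ModuleCat.of A ω) x hx (add_comm 1 d)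
    have h0 : EV A d (LinearMap.ker g) ω := by
      refine ischebeck hωd 0 _ ?_ d (by omega)
      exact (Module.supportDim_le_of_injective (Submodule.subtype _) Subtype.val_injective).trans
          (by simpa using hdim)
    rw [← hy, EV_iff.1 h0 y, Abelian.Ext.comp_zero]

lemma end_base {d : ℕ} (hωb : EVbound A d ω) (hωd : depthGE A d ω)
    (hk : ¬ EV A d (ResidueField A) ω) {N V : Type}
    [AddCommGroup N] [Module A N] [AddCommGroup V] [Module A V] [Module.Finite A N]
    [Module.Finite A V] (q : A →ₗ[A] N) (p : ω →ₗ[A] V) (hq : Function.Surjective q)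
    (hp : Function.Surjective p)
    (hqp : ∀ r, q r = 0 → r • p = 0)
    (hker : LinearMap.ker p ≤ (LinearMap.ker q : Ideal A) • (⊤ : Submodule A ω))
    (hdim : Module.supportDim A N ≤ 0)
    (σ : V →ₗ[A] E A d N ω) (hσ : Function.Surjective σ)
    (τ : E A 0 (ResidueField A) V →ₗ[A] ResidueField A) (hτ : Function.Injective τ) :
    (∀ r, r • p = 0 → q r = 0) ∧ ∀ f : ω →ₗ[A] V, ∃ r : A, f = r • p := by
  have hA : ∀ r, r • p = 0 → q r = 0 := by
    intro r hr
    have hV : ∀ v : V, r • v = 0 := by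
      intro v
      obtain ⟨w, rfl⟩ := hp v
      exact LinearMap.congr_fun hr w
    have hE : ∀ e : E A d N ω, r • e = 0 := by
      intro e
      obtain ⟨v, rfl⟩ := hσ e
      rw [← map_smul, hV, map_zero]
    let g := (LinearMap.lsmul A N r).rangeRestrict
    have hL : EV A d (LinearMap.range (LinearMap.lsmul A N r)) ω := by
      rw [EV_iff]
      intro x
      apply lift_pi_injective hωd hdim g (LinearMap.surjective_rangeRestrict _) x
      obtain ⟨y, rfl⟩ := Abelian.Ext.contravariant_sequence_exact₁
        (shortExact (f := (LinearMap.range (LinearMap.lsmul A N r)).subtype)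
          Subtype.val_injective (exact_subtype_mkQ _) (Submodule.mkQ_surjective _))
        (ModuleCat.of A ω) x (add_comm 1 d) (EV_iff.1 (hωb _ (d + 1) (by omega)) _)
      refine Eq.trans ?_ ((E_lsmul_comp y r).trans (hE y))
      exact (Abelian.Ext.mk₀_comp_mk₀_assoc _ _ _)
    have hsub : Subsingleton (LinearMap.range (LinearMap.lsmul A N r)) := by
      by_contra hne
      rw [not_subsingleton_iff_nontrivial] at hne
      refine not_EV_of_depth hωb hk 0 _ (fun i hi => by omega) ?_ d rfl hL
      intro h0
      have h1 : depthGE A 1 (LinearMap.range (LinearMap.lsmul A N r)) := by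
        intro i hi
        obtain rfl : i = 0 := by omega
        exact h0
      have h2 := (depthGE_le_supportDim h1).trans
        ((Module.supportDim_le_of_injective (Submodule.subtype _) Subtype.val_injective).trans hdim)
      norm_num at h2
    have h3 := congrArg Subtype.val (hsub.elim ⟨r • q 1, LinearMap.mem_range_self _ (q 1)⟩ 0)
    simpa [← map_smul] using h3
  refine ⟨hA, ?_⟩
  have hVJ : ∀ r, q r = 0 → ∀ v : V, r • v = 0 := by
    intro r hr v
    obtain ⟨w, rfl⟩ := hp v
    exact LinearMap.congr_fun (hqp r hr) w
  let e0 : (ResidueField A →ₗ[A] V) ≃ₗ[A] E A 0 (ResidueField A) V :=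
    (ModuleCat.homLinearEquiv (S := A) (M := ModuleCat.of A (ResidueField A))
      (N := ModuleCat.of A V)).symm.trans (Abelian.Ext.linearEquiv₀ (R := A)).symm
  have hlen := length_hom_le (τ ∘ₗ e0.toLinearMap) (hτ.comp e0.injective)
  have hVN : Module.length A V ≤ Module.length A N := by
    refine le_trans ?_ (hlen N)
    let j : V →ₗ[A] (N →ₗ[A] V) :=
      { toFun := fun v => desc q hq (LinearMap.toSpanSingleton A V v)
          (fun r hr => by simpa using hVJ r hr v)
        map_add' := by
          intro v w
          ext n
          obtain ⟨a, rfl⟩ := hq n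
          simp
        map_smul' := by
          intro c v
          ext n
          obtain ⟨a, rfl⟩ := hq n
          simp only [desc_apply, LinearMap.toSpanSingleton_apply, LinearMap.smul_apply,
              RingHom.id_apply]
          exact smul_comm _ _ _ }
    refine Module.length_le_of_injective j ?_
    intro v w hvw
    have h1 := LinearMap.congr_fun hvw (q 1)
    simpa [j] using h1
  have hfin : Module.length A N ≠ ⊤ := by
    exact length_ne_top_of_supportDim N hdim
  have hHom : Module.length A (ω →ₗ[A] V) ≤ Module.length A N := by
    refine le_trans ?_ ((hlen V).trans hVN)
    refine Module.length_le_of_surjective (LinearMap.lcomp A V p) ?_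
    intro f
    have hf : LinearMap.ker p ≤ LinearMap.ker f := by
      refine hker.trans (Submodule.smul_le.2 ?_)
      intro r hr w _
      rw [LinearMap.mem_ker, map_smul]
      exact hVJ r hr _
    exact ⟨desc p hp f fun m hm => hf hm, LinearMap.ext fun w =>
        desc_apply p hp f (fun m hm => hf hm) w⟩
  let ι : N →ₗ[A] (ω →ₗ[A] V) := desc q hq (LinearMap.toSpanSingleton A _ p)
    (fun r hr => by simpa using hqp r hr)
  have hι : ∀ a, ι (q a) = a • p := by
    intro a
    simp [ι]
  have hιi : Function.Injective ι := by
    rw [injective_iff_map_eq_zero]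
    intro n hn
    obtain ⟨a, rfl⟩ := hq n
    exact hA a ((hι a).symm.trans hn)
  have hadd := Module.length_eq_add_of_exact ι (LinearMap.range ι).mkQ hιi
    (Submodule.mkQ_surjective _) (LinearMap.exact_map_mkQ_range ι)
  have h0 : Module.length A ((ω →ₗ[A] V) ⧸ LinearMap.range ι) = 0 := by
    rw [hadd] at hHom
    by_contra hne
    have h1 : Module.length A N + 0 < Module.length A N + _ :=
      (ENat.add_lt_add_iff_left hfin).2 (pos_iff_ne_zero.2 hne)
    rw [add_zero] at h1
    exact absurd hHom (not_le.2 h1)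
  rw [Module.length_eq_zero_iff, Submodule.Quotient.subsingleton_iff] at h0
  intro f
  obtain ⟨n, hn⟩ : f ∈ LinearMap.range ι := h0 ▸ Submodule.mem_top
  obtain ⟨a, rfl⟩ := hq n
  exact ⟨a, hn.symm.trans (hι a)⟩

lemma end_descent {d : ℕ} (hωb : EVbound A d ω) (hωd : depthGE A d ω)
    (hk : ¬ EV A d (ResidueField A) ω) (e : ℕ) : ∀ (N V : Type)
    [AddCommGroup N] [Module A N] [AddCommGroup V] [Module A V] [Module.Finite A N]
    [Module.Finite A V] (q : A →ₗ[A] N) (p : ω →ₗ[A] V) (j : ℕ), j + e = d →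
    Function.Surjective q → Function.Surjective p →
    (∀ r, q r = 0 → r • p = 0) →
    LinearMap.ker p ≤ (LinearMap.ker q : Ideal A) • (⊤ : Submodule A ω) →
    Module.supportDim A N ≤ e →
    depthGE A e N → depthGE A e V →
    (∃ σ : V →ₗ[A] E A j N ω, Function.Surjective σ) →
    (∃ τ : E A e (ResidueField A) V →ₗ[A] ResidueField A, Function.Injective τ) →
    (∀ r, r • p = 0 → q r = 0) ∧ ∀ f : ω →ₗ[A] V, ∃ r : A, f = r • p := by
  induction e with
  | zero =>
    rintro N V _ _ _ _ _ _ q p j hj hq hp hqp hker hdim _ _ ⟨σ, hσ⟩ ⟨τ, hτ⟩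
    obtain rfl : j = d := by omega
    exact end_base hωb hωd hk q p hq hp hqp hker hdim σ hσ τ hτ
  | succ e ih =>
    rintro N V _ _ _ _ _ _ q p j hj hq hp hqp hker hdim hN hV ⟨σ, hσ⟩ ⟨τ, hτ⟩
    obtain ⟨x, hx, hxN, hxV⟩ := exists_regular₂ hN hV
    let qN : N →ₗ[A] QuotSMulTop x N := Submodule.mkQ _
    let qV : V →ₗ[A] QuotSMulTop x V := Submodule.mkQ _
    have hqN : ∀ n, qN n = 0 → ∃ n', n = x • n' := by
      intro n hn
      obtain ⟨n', h⟩ := (exact_lsmul_mkQ x n).1 hn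
      exact ⟨n', h.symm⟩
    have hqV : ∀ n, qV n = 0 → ∃ n', n = x • n' := by
      intro n hn
      obtain ⟨n', h⟩ := (exact_lsmul_mkQ x n).1 hn
      exact ⟨n', h.symm⟩
    have hqN' : ∀ n, qN (x • n) = 0 := fun n => (exact_lsmul_mkQ x _).2 ⟨n, rfl⟩
    have hqV' : ∀ n, qV (x • n) = 0 := fun n => (exact_lsmul_mkQ x _).2 ⟨n, rfl⟩
    obtain ⟨h1, h2⟩ := ih (QuotSMulTop x N) (QuotSMulTop x V) (qN ∘ₗ q) (qV ∘ₗ p) (j + 1) (by omega)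
      ((Submodule.mkQ_surjective _).comp hq) ((Submodule.mkQ_surjective _).comp hp)
      (by
        intro r hr
        obtain ⟨n', hn'⟩ := hqN _ hr
        obtain ⟨s, rfl⟩ := hq n'
        have h0 : q (r - x * s) = 0 := by
          rw [map_sub, hn', ← smul_eq_mul, map_smul, sub_self]
        have h3 := hqp _ h0
        ext w
        have h4 := LinearMap.congr_fun h3 w
        rw [LinearMap.smul_apply, sub_smul, LinearMap.zero_apply, sub_eq_zero, mul_smul] at h4
        rw [LinearMap.smul_apply, LinearMap.comp_apply, ← map_smul, h4, hqV', LinearMap.zero_apply])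
      (by
        intro w hw
        obtain ⟨v, hv⟩ := hqV _ hw
        obtain ⟨w', rfl⟩ := hp v
        have h3 : w - x • w' ∈ LinearMap.ker p := by
          rw [LinearMap.mem_ker, map_sub, hv, map_smul, sub_self]
        have h4 : w = (w - x • w') + x • w' := by abel
        rw [h4]
        refine Submodule.add_mem _ ?_ (Submodule.smul_mem_smul ?_ trivial)
        · refine Submodule.smul_mono_left ?_ (hker h3)
          intro r hr
          rw [LinearMap.mem_ker] at hr
          rw [LinearMap.mem_ker, LinearMap.comp_apply, hr, map_zero]
        · have h5 : q x = x • q 1 := by rw [← map_smul, smul_eq_mul, mul_one]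
          rw [LinearMap.mem_ker, LinearMap.comp_apply, h5, hqN'])
      (supportDim_quotSMulTop_le hx hxN hdim) (hN.quot hxN) (hV.quot hxV)
      (by
        let c := connL (f := LinearMap.lsmul A N x) hxN (exact_lsmul_mkQ x)
          (Submodule.mkQ_surjective _) j ω
        have hc : Function.Surjective c := by
          intro y
          obtain ⟨z, hz⟩ := Abelian.Ext.contravariant_sequence_exact₃
            (shortExact (f := LinearMap.lsmul A N x) hxN (exact_lsmul_mkQ x)
              (Submodule.mkQ_surjective _)) (ModuleCat.of A ω) y
            (EV_iff.1 (hωb.nv (e + 1) N hN (j + 1) (by omega)) _) (add_comm 1 j)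
          exact ⟨z, hz⟩
        refine ⟨desc qV (Submodule.mkQ_surjective _) (c ∘ₗ σ) ?_, ?_⟩
        · intro v hv
          obtain ⟨v', rfl⟩ := hqV v hv
          rw [LinearMap.comp_apply, map_smul, ← E_lsmul_comp]
          exact (shortExact (f := LinearMap.lsmul A N x) hxN (exact_lsmul_mkQ x)
              (Submodule.mkQ_surjective _)).extClass_comp_assoc (h := add_comm 1 j) _
        · intro y
          obtain ⟨z, rfl⟩ := hc y
          obtain ⟨v, rfl⟩ := hσ z
          exact ⟨qV v, desc_apply _ _ _ _ _⟩)
      (by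
        refine ⟨τ ∘ₗ connR (f := LinearMap.lsmul A V x) hxV (exact_lsmul_mkQ x)
          (Submodule.mkQ_surjective _) e (ResidueField A), hτ.comp ?_⟩
        rw [injective_iff_map_eq_zero]
        intro y hy
        obtain ⟨z, hz⟩ := Abelian.Ext.covariant_sequence_exact₃ _
            (shortExact (f := LinearMap.lsmul A V x) hxV (exact_lsmul_mkQ x)
              (Submodule.mkQ_surjective _)) y rfl hy
        rw [← hz, EV_iff.1 (hV e (by omega)) z, Abelian.Ext.zero_comp])
    refine ⟨?_, ?_⟩
    · let J : Ideal A := LinearMap.ker (LinearMap.toSpanSingleton A (ω →ₗ[A] V) p)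
      have hJ : ∀ r, r ∈ J ↔ r • p = 0 := fun r => by simp [J]
      have hle : J ≤ LinearMap.ker q := by
        refine Submodule.le_of_le_smul_of_le_jacobson_bot (I := maximalIdeal A)
            (IsNoetherian.noetherian _)
          (IsLocalRing.maximalIdeal_le_jacobson _) ?_
        intro r hr
        have h3 : qN (q r) = 0 := by
          refine h1 r ?_
          rw [← LinearMap.comp_smul, (hJ r).1 hr, LinearMap.comp_zero]
        obtain ⟨n', hn'⟩ := hqN _ h3
        obtain ⟨s, rfl⟩ := hq n'
        have h4 : q (r - x * s) = 0 := by
          rw [map_sub, hn', ← smul_eq_mul, map_smul, sub_self]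
        have h5 : r = (r - x * s) + x * s := by ring
        rw [h5]
        refine Submodule.add_mem_sup h4 (Ideal.mul_mem_mul hx ((hJ s).2 ?_))
        have h6 := hqp _ h4
        rw [sub_smul, (hJ r).1 hr, zero_sub, neg_eq_zero, mul_smul] at h6
        ext w
        apply hxV
        simpa using LinearMap.congr_fun h6 w
      exact fun r hr => hle ((hJ r).2 hr)
    · let P : Submodule A (ω →ₗ[A] V) := Submodule.span A {p}
      have hle : (⊤ : Submodule A (ω →ₗ[A] V)) ≤ P := by
        refine Submodule.le_of_le_smul_of_le_jacobson_bot (I := maximalIdeal A)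
            (IsNoetherian.noetherian _)
          (IsLocalRing.maximalIdeal_le_jacobson _) ?_
        intro f _
        obtain ⟨r, hr⟩ := h2 (qV ∘ₗ f)
        have h3 : ∀ w, ∃ v, (f - r • p) w = x • v := by
          intro w
          apply hqV
          have := LinearMap.congr_fun hr w
          simp only [LinearMap.comp_apply, LinearMap.smul_apply] at this
          rw [LinearMap.sub_apply, map_sub, this, LinearMap.smul_apply, map_smul, sub_self]
        choose g hg using h3
        have hgl : ∃ g' : ω →ₗ[A] V, f - r • p = x • g' := by
          refine ⟨{ toFun := g, map_add' := ?_, map_smul' := ?_ }, ?_⟩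
          · intro a b
            apply hxV
            simp only [smul_add, ← hg, map_add]
          · intro c a
            apply hxV
            simp only [RingHom.id_apply]
            rw [← hg, smul_comm, ← hg, map_smul]
          · ext w
            exact hg w
        obtain ⟨g', hg'⟩ := hgl
        rw [← sub_add_cancel f (r • p), hg', add_comm]
        exact Submodule.add_mem_sup (Submodule.smul_mem _ _ (Submodule.subset_span rfl))
          (Submodule.smul_mem_smul hx trivial)
      intro f
      obtain ⟨r, hr⟩ := Submodule.mem_span_singleton.1 (hle (x := f) trivial)
      exact ⟨r, hr.symm⟩

end endCanonical

/-- The properties of a canonical module that are stable under localization. -/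
structure Good (A : Type) [CommRing A] [IsNoetherianRing A] [IsLocalRing A] (W : Type)
    [AddCommGroup W] [Module A W] (h : ℕ) : Prop where
  fin : Module.Finite A W
  nv : ∀ (j : ℕ) (N : Type) [AddCommGroup N] [Module A N] [Module.Finite A N],
    depthGE A j N → ∀ i, h < i + j → EV A i N W
  depthW : depthGE A h W
  depthA : depthGE A h A
  dim : ringKrullDim A ≤ h
  faithful : ∀ r : A, (∀ w : W, r • w = 0) → r = 0
  endo : ∀ f : W →ₗ[A] W, ∃ r : A, ∀ w, f w = r • w

lemma EVbound_of_hasFID {A : Type} [CommRing A] {Y : Type} [AddCommGroup Y] [Module A Y]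
    (h : HasFID A Y) : ∃ n, EVbound A n Y := by
  obtain ⟨n, hn⟩ := h
  exact ⟨n, fun N _ _ _ m hm => ext1_subsingleton_iff.1 (hn N m hm)⟩

section depthLemmas

variable {A : Type} [CommRing A]
variable {M M₁ M₂ M₃ N : Type} [AddCommGroup M] [Module A M] [AddCommGroup N] [Module A N]
  [AddCommGroup M₁] [Module A M₁] [AddCommGroup M₂] [Module A M₂] [AddCommGroup M₃] [Module A M₃]
  {f : M₁ →ₗ[A] M₂} {g : M₂ →ₗ[A] M₃}

lemma EV_zero_of_injective (hf : Function.Injective f) (h : EV A 0 M M₂) : EV A 0 M M₁ := by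
  rw [EV_zero_iff] at *
  intro φ
  ext x
  apply hf
  simpa using LinearMap.congr_fun (h (f ∘ₗ φ)) x

lemma EV.pi {i : ℕ} (h : EV A i M N) (n : ℕ) : EV A i M (Fin n → N) := by
  induction n with
  | zero => exact EV_of_subsingleton_right i
  | succ n ih => exact (h.prod_right ih).congr_right (Fin.consLinearEquiv A fun _ => N)

lemma EV.hom_free {i : ℕ} (h : EV A i M N) (n : ℕ) : EV A i M ((Fin n → A) →ₗ[A] N) :=
  (h.pi n).congr_right ((Pi.basisFun A (Fin n)).constr A)

section loc
variable [IsLocalRing A]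

lemma depthGE.ker (hf : Function.Injective f) (hfg : Function.Exact f g)
    (hg : Function.Surjective g) {j : ℕ} (h₂ : depthGE A (j + 1) M₂) (h₃ : depthGE A j M₃) :
    depthGE A (j + 1) M₁ := by
  rintro (_ | i) hi
  · exact EV_zero_of_injective hf (h₂ 0 hi)
  · exact EV.cov₁ hf hfg hg (h₃ i (by omega)) (h₂ (i + 1) hi)

lemma depthGE.ker' (hf : Function.Injective f) (hfg : Function.Exact f g)
    (hg : Function.Surjective g) {j : ℕ} (h₂ : depthGE A j M₂) (h₃ : depthGE A j M₃) :
    depthGE A j M₁ := by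
  rcases j with _ | j
  · exact fun i hi => by omega
  · exact depthGE.ker hf hfg hg h₂ (h₃.mono (by omega))

lemma depthGE.sub (hf : Function.Injective f) {j : ℕ} (hj : j ≤ 1) (h : depthGE A j M₂) :
    depthGE A j M₁ := by
  intro i hi
  obtain rfl : i = 0 := by omega
  exact EV_zero_of_injective hf (h 0 hi)

lemma depthGE.pi {j : ℕ} (h : depthGE A j N) (n : ℕ) : depthGE A j (Fin n → N) :=
  fun i hi => (h i hi).pi n

lemma depthGE.hom_free {j : ℕ} (h : depthGE A j N) (n : ℕ) : depthGE A j ((Fin n → A) →ₗ[A] N) :=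
  fun i hi => (h i hi).hom_free n

lemma depthGE.retract {j : ℕ} (h : depthGE A j N) (s : M →ₗ[A] N) (r : N →ₗ[A] M)
    (hrs : r ∘ₗ s = LinearMap.id) : depthGE A j M :=
  fun i hi => (h i hi).retract_right s r hrs

end loc

variable (W : Type) [AddCommGroup W] [Module A W]

lemma dmap_injective (hg : Function.Surjective g) : Function.Injective (dmap A W g) :=
  LinearMap.lcomp_injective_of_surjective g hg

lemma dmap_exact (hfg : Function.Exact f g) (hg : Function.Surjective g) :
    Function.Exact (dmap A W g) (dmap A W f) :=
  LinearMap.exact_lcomp_of_exact_of_surjective W hfg hg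

variable {W} in
lemma dmap_surjective (hf : Function.Injective f) (hfg : Function.Exact f g)
    (hg : Function.Surjective g) (h : EV A 1 M₃ W) : Function.Surjective (dmap A W f) :=
  fun φ => EV.exists_extend hf hfg hg h φ

lemma deltaMap_apply (x : M) (f : M →ₗ[A] W) : deltaMap A W M x f = f x := rfl

lemma deltaMap_natural (g : M₂ →ₗ[A] M₃) (x : M₂) :
    dmap A W (dmap A W g) (deltaMap A W M₂ x) = deltaMap A W M₃ (g x) := rfl

lemma deltaMap_surjective_of_ses (hf : Function.Injective f) (hfg : Function.Exact f g)
    (hg : Function.Surjective g) (h₁ : EV A 1 M₃ W) (h₂ : EV A 1 (M₁ →ₗ[A] W) W)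
    (hδ : Function.Surjective (deltaMap A W M₂)) : Function.Surjective (deltaMap A W M₃) := by
  intro ψ
  obtain ⟨y, rfl⟩ := dmap_surjective (dmap_injective W hg) (dmap_exact W hfg hg)
    (dmap_surjective hf hfg hg h₁) h₂ ψ
  obtain ⟨x, rfl⟩ := hδ y
  exact ⟨g x, (deltaMap_natural W g x).symm⟩

lemma deltaMap_injective_of_ses (hf : Function.Injective f) (hfg : Function.Exact f g)
    (hg : Function.Surjective g) (h₁ : EV A 1 M₃ W)
    (hδ : Function.Injective (deltaMap A W M₂)) (hδ₁ : Function.Surjective (deltaMap A W M₁)) :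
    Function.Injective (deltaMap A W M₃) := by
  rw [injective_iff_map_eq_zero]
  intro z hz
  obtain ⟨y, rfl⟩ := hg z
  rw [← deltaMap_natural] at hz
  obtain ⟨l, hl⟩ := ((dmap_exact W (dmap_exact W hfg hg) (dmap_surjective hf hfg hg h₁)) _).1 hz
  obtain ⟨x, rfl⟩ := hδ₁ l
  rw [deltaMap_natural] at hl
  exact (hfg y).2 ⟨x, hδ hl⟩

end depthLemmas

section dualDepth

variable {A : Type} [CommRing A] [IsNoetherianRing A] [IsLocalRing A]
variable {W : Type} [AddCommGroup W] [Module A W] [Module.Finite A W]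

lemma depthGE_dual_one (h : depthGE A 1 W) (N : Type) [AddCommGroup N] [Module A N]
    [Module.Finite A N] : depthGE A 1 (N →ₗ[A] W) := by
  obtain ⟨n, q, hq⟩ := Module.Finite.exists_fin' A N
  exact (h.hom_free n).sub (dmap_injective W hq) le_rfl

lemma depthGE_dual_two (h : depthGE A 2 W) (N : Type) [AddCommGroup N] [Module A N]
    [Module.Finite A N] : depthGE A 2 (N →ₗ[A] W) := by
  obtain ⟨n, q, hq⟩ := Module.Finite.exists_fin' A N
  let r := dmap A W (LinearMap.ker q).subtype
  have hex := dmap_exact W (exact_ker_subtype q) hq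
  refine depthGE.ker (g := r.rangeRestrict) (dmap_injective W hq) ?_
    (LinearMap.surjective_rangeRestrict _) (h.hom_free n) ?_
  · intro y
    rw [← hex y]
    exact ⟨fun h => congrArg Subtype.val h, fun h => Subtype.ext h⟩
  · exact (depthGE_dual_one (h.mono (by omega)) (LinearMap.ker q)).sub (f :=
        (LinearMap.range r).subtype)
      Subtype.val_injective le_rfl

lemma depthGE_dual {j : ℕ} (hj : j ≤ 2) (h : depthGE A j W) (N : Type) [AddCommGroup N] [Module A N]
    [Module.Finite A N] : depthGE A j (N →ₗ[A] W) := by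
  interval_cases j
  · exact fun i hi => by omega
  · exact depthGE_dual_one h N
  · exact depthGE_dual_two h N

end dualDepth

section good

variable {A : Type} [CommRing A] [IsNoetherianRing A] [IsLocalRing A]
variable {ω : Type} [AddCommGroup ω] [Module A ω]

lemma good_of_canonical {d : ℕ} (hdim : ringKrullDim A = d) (hCM : (d : ℕ∞) ≤ rdepth A A)
    (hω : IsCanonicalModule A d ω) : Good A ω d := by
  obtain ⟨⟨hfin, hdep⟩, hfid, ⟨e⟩⟩ := hω
  obtain ⟨n, hn⟩ := EVbound_of_hasFID hfid
  have hb : EVbound A d ω := hn.bass hdim.le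
  have hωd := le_rdepth_iff.1 hdep
  have hAd := le_rdepth_iff.1 hCM
  let e' : E A d (ResidueField A) ω ≃ₗ[A] ResidueField A := (ext1Equiv _ _ d).symm.trans e
  have hk : ¬ EV A d (ResidueField A) ω := by
    intro h
    have : Subsingleton (ResidueField A) := by
      have : Subsingleton (E A d (ResidueField A) ω) := h
      exact e'.symm.toEquiv.subsingleton
    exact false_of_nontrivial_of_subsingleton (ResidueField A)
  let e0 : ω ≃ₗ[A] E A 0 A ω :=
    (LinearMap.ringLmapEquivSelf A A ω).symm.trans
      ((ModuleCat.homLinearEquiv (S := A) (M := ModuleCat.of A A)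
      (N := ModuleCat.of A ω)).symm.trans (Abelian.Ext.linearEquiv₀ (R := A)).symm)
  obtain ⟨h1, h2⟩ := end_descent hb hωd hk d A ω LinearMap.id LinearMap.id 0 (by omega)
    Function.surjective_id Function.surjective_id (by
      intro r hr
      rw [LinearMap.id_apply] at hr
      rw [hr, zero_smul]) (by simp) ((Module.supportDim_self_eq_ringKrullDim (R := A)).trans
          hdim).le
    hAd hωd ⟨e0.toLinearMap, e0.surjective⟩ ⟨e'.toLinearMap, e'.injective⟩
  refine ⟨hfin, hb.nv, hωd, hAd, hdim.le, ?_, ?_⟩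
  · intro r hr
    exact h1 r (LinearMap.ext hr)
  · intro f
    obtain ⟨r, hr⟩ := h2 f
    exact ⟨r, fun w => by rw [hr]; rfl⟩

namespace Good

variable {h : ℕ}

lemma depth_free (G : Good A ω h) (n : ℕ) : depthGE A h (Fin n → A) := G.depthA.pi n

lemma delta_free_injective (G : Good A ω h) (n : ℕ) :
    Function.Injective (deltaMap A ω (Fin n → A)) := by
  rw [injective_iff_map_eq_zero]
  intro x hx
  ext i
  apply G.faithful
  intro w
  have := LinearMap.congr_fun hx ((LinearMap.toSpanSingleton A ω w) ∘ₗ LinearMap.proj i)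
  simpa [deltaMap_apply] using this

lemma delta_free_surjective (G : Good A ω h) (n : ℕ) :
    Function.Surjective (deltaMap A ω (Fin n → A)) := by
  intro ψ
  have h1 : ∀ i : Fin n, ∃ r : A, ∀ w,
      ψ ((LinearMap.toSpanSingleton A ω w) ∘ₗ LinearMap.proj i) = r • w := by
    intro i
    exact G.endo {
      toFun := fun w => ψ ((LinearMap.toSpanSingleton A ω w) ∘ₗ LinearMap.proj i)
      map_add' := by
        intro a b
        rw [← map_add]
        congr 1
        ext
        simp
      map_smul' := by
        intro c a
        rw [RingHom.id_apply, ← map_smul]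
        congr 1
        refine LinearMap.ext fun x => ?_
        simp only [LinearMap.comp_apply, LinearMap.toSpanSingleton_apply, LinearMap.smul_apply]
        exact smul_comm _ _ _ }
  choose r hr using h1
  refine ⟨r, LinearMap.ext fun f => ?_⟩
  have hf : f = ∑ i, (LinearMap.toSpanSingleton A ω (f (Pi.single i 1))) ∘ₗ LinearMap.proj i := by
    refine (Pi.basisFun A (Fin n)).ext fun j => ?_
    simp [LinearMap.sum_apply, Pi.single_apply]
  rw [deltaMap_apply]
  conv_rhs => rw [hf]
  rw [map_sum]
  simp_rw [hr]
  conv_lhs => rw [← (Pi.basisFun A (Fin n)).sum_repr r]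
  simp

lemma mcm_dual_aux (G : Good A ω h) (j : ℕ) :
    j ≤ h → ∀ (Z : Type) [AddCommGroup Z] [Module A Z] [Module.Finite A Z],
    depthGE A h Z → depthGE A j (Z →ₗ[A] ω) := by
  induction j with
  | zero => exact fun _ _ _ _ _ _ i hi => by omega
  | succ j ih =>
    intro hj Z _ _ _ hZ
    obtain ⟨n, q, hq⟩ := Module.Finite.exists_fin' A Z
    have hL := depthGE.ker' (f := (LinearMap.ker q).subtype) Subtype.val_injective
      (exact_ker_subtype q) hq (G.depth_free n) hZ
    exact depthGE.ker (dmap_injective ω hq) (dmap_exact ω (exact_ker_subtype q) hq)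
      (dmap_surjective Subtype.val_injective (exact_ker_subtype q) hq (G.nv h Z hZ 1 (by omega)))
      ((G.depthW.mono hj).hom_free n) (ih (by omega) _ hL)

lemma mcm_dual (G : Good A ω h) {Z : Type} [AddCommGroup Z] [Module A Z] [Module.Finite A Z]
    (hZ : depthGE A h Z) : depthGE A h (Z →ₗ[A] ω) := G.mcm_dual_aux h le_rfl Z hZ

lemma ev_one (G : Good A ω h) {Z : Type} [AddCommGroup Z] [Module A Z] [Module.Finite A Z]
    (hZ : depthGE A h Z) : EV A 1 Z ω := G.nv h Z hZ 1 (by omega)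

lemma finite_dual (G : Good A ω h) (Z : Type) [AddCommGroup Z] [Module A Z] [Module.Finite A Z] :
    Module.Finite A (Z →ₗ[A] ω) := by
  have := G.fin
  infer_instance

lemma delta_surjective (G : Good A ω h) {Z : Type} [AddCommGroup Z] [Module A Z] [Module.Finite A Z]
    (hZ : depthGE A h Z) : Function.Surjective (deltaMap A ω Z) := by
  obtain ⟨n, q, hq⟩ := Module.Finite.exists_fin' A Z
  have hL := depthGE.ker' (f := (LinearMap.ker q).subtype) Subtype.val_injective
      (exact_ker_subtype q) hq (G.depth_free n) hZ
  have := G.finite_dual (LinearMap.ker q)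
  exact deltaMap_surjective_of_ses ω Subtype.val_injective (exact_ker_subtype q) hq (G.ev_one hZ)
    (G.ev_one (G.mcm_dual hL)) (G.delta_free_surjective n)

lemma delta_bijective (G : Good A ω h) {Z : Type} [AddCommGroup Z] [Module A Z] [Module.Finite A Z]
    (hZ : depthGE A h Z) : Function.Bijective (deltaMap A ω Z) := by
  refine ⟨?_, G.delta_surjective hZ⟩
  obtain ⟨n, q, hq⟩ := Module.Finite.exists_fin' A Z
  have hL := depthGE.ker' (f := (LinearMap.ker q).subtype) Subtype.val_injective
      (exact_ker_subtype q) hq (G.depth_free n) hZ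
  exact deltaMap_injective_of_ses ω Subtype.val_injective (exact_ker_subtype q) hq (G.ev_one hZ)
    (G.delta_free_injective n) (G.delta_surjective hL)

lemma delta_surjective_of_le_two (G : Good A ω h) (h2 : h ≤ 2) {C : Type} [AddCommGroup C]
    [Module A C]
    [Module.Finite A C] (hC : EV A 1 C ω) : Function.Surjective (deltaMap A ω C) := by
  obtain ⟨n, q, hq⟩ := Module.Finite.exists_fin' A C
  have := G.fin
  have := G.finite_dual (LinearMap.ker q)
  exact deltaMap_surjective_of_ses ω Subtype.val_injective (exact_ker_subtype q) hq hC
    (G.ev_one (depthGE_dual h2 G.depthW _)) (G.delta_free_surjective n)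

lemma delta_injective_of_le_one (G : Good A ω h) (h1 : h ≤ 1) {C : Type} [AddCommGroup C]
    [Module A C]
    [Module.Finite A C] (hC : EV A 1 C ω) : Function.Injective (deltaMap A ω C) := by
  obtain ⟨n, q, hq⟩ := Module.Finite.exists_fin' A C
  exact deltaMap_injective_of_ses ω Subtype.val_injective (exact_ker_subtype q) hq hC
    (G.delta_free_injective n) (G.delta_surjective
      ((G.depth_free n).sub (f := (LinearMap.ker q).subtype) Subtype.val_injective h1))

end Good

end good

section localization

variable {A : Type} [CommRing A] [IsNoetherianRing A] (S : Submonoid A)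
variable {M N W M₁ M₂ M₃ : Type} [AddCommGroup M] [Module A M] [AddCommGroup N] [Module A N]
  [AddCommGroup W] [Module A W]
  [AddCommGroup M₁] [Module A M₁] [AddCommGroup M₂] [Module A M₂] [AddCommGroup M₃] [Module A M₃]
  {f : M₁ →ₗ[A] M₂} {g : M₂ →ₗ[A] M₃}

lemma loc_exact (h : Function.Exact f g) :
    Function.Exact (LocalizedModule.map S f) (LocalizedModule.map S g) :=
  LocalizedModule.map_exact S f g h

lemma loc_comp (f : M₁ →ₗ[A] M₂) (g : M₂ →ₗ[A] M₃) :
    LocalizedModule.map S (g ∘ₗ f) = LocalizedModule.map S g ∘ₗ LocalizedModule.map S f := by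
  ext x
  induction x using LocalizedModule.induction_on with
  | h m s => simp [LocalizedModule.map_mk]

lemma loc_map_mk (f : M₁ →ₗ[A] M₂) (x : M₁) (s : S) :
    LocalizedModule.map S f (LocalizedModule.mk x s) = LocalizedModule.mk (f x) s :=
  LocalizedModule.map_mk S f x s

instance loc_finite [Module.Finite A M] : Module.Finite (Localization S) (LocalizedModule S M) :=
  Module.Finite.of_isLocalizedModule S (LocalizedModule.mkLinearMap S M)

lemma exists_loc_map [Module.Finite A N]
    (φ : LocalizedModule S N →ₗ[Localization S] LocalizedModule S W) :
    ∃ (f : N →ₗ[A] W) (s : S), LocalizedModule.map S f = (s : A) • φ := by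
  have := Module.finitePresentation_of_finite A N
  obtain ⟨⟨f, s⟩, h⟩ := IsLocalizedModule.surj S (LocalizedModule.map S (M := N) (N := W)) φ
  exact ⟨f, s, h.symm⟩

lemma loc_smul_injective (s : S) {x y : LocalizedModule S M} (h : (s : A) • x = (s : A) • y) :
    x = y :=
  (IsLocalizedModule.smul_injective (LocalizedModule.mkLinearMap S M) s) h

lemma loc_hom_injective (s : S) {φ ψ : LocalizedModule S N →ₗ[Localization S] LocalizedModule S W}
    (h : (s : A) • φ = (s : A) • ψ) : φ = ψ := by
  ext x
  exact loc_smul_injective S s (LinearMap.congr_fun h x)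

lemma EV.loc (i : ℕ) : ∀ (N : Type) [AddCommGroup N] [Module A N] [Module.Finite A N], EV A i N W →
    EV (Localization S) i (LocalizedModule S N) (LocalizedModule S W) := by
  have hfree : ∀ n i, EV (Localization S) (i + 1) (LocalizedModule S (Fin n → A))
      (LocalizedModule S W) := by
    intro n i
    have : Module.Projective (Localization S) (LocalizedModule S (Fin n → A)) :=
      Module.projective_of_isLocalizedModule S (LocalizedModule.mkLinearMap S (Fin n → A))
    exact EV_of_projective i
  induction i with
  | zero =>
    intro N _ _ _ h
    rw [EV_zero_iff] at *
    intro φ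
    obtain ⟨f, s, hf⟩ := exists_loc_map S φ
    rw [h f, map_zero] at hf
    exact loc_hom_injective S s (by rw [← hf, smul_zero])
  | succ i ih =>
    intro N _ _ _ h
    obtain ⟨n, q, hq⟩ := Module.Finite.exists_fin' A N
    have hi : Function.Injective (LinearMap.ker q).subtype := Subtype.val_injective
    have hi' := LocalizedModule.map_injective S _ hi
    have hq' := LocalizedModule.map_surjective S _ hq
    have hex := loc_exact S (exact_ker_subtype q)
    rcases i with _ | i
    · refine EV_one_of_extend hi' hex hq' ?_ (hfree n 0)
      intro φ
      obtain ⟨f, s, hf⟩ := exists_loc_map S φ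
      obtain ⟨ψ, hψ⟩ := EV.exists_extend hi (exact_ker_subtype q) hq h f
      obtain ⟨χ, hχ⟩ : ∃ χ, (s : A) • χ = LocalizedModule.map S ψ := by
        refine ⟨Localization.mk 1 s • LocalizedModule.map S ψ, ?_⟩
        ext x
        simp only [LinearMap.smul_apply]
        rw [← smul_assoc, Localization.smul_mk, smul_eq_mul, mul_one, Localization.mk_self,
            one_smul]
      refine ⟨χ, loc_hom_injective S s ?_⟩
      rw [← hf, ← hψ, loc_comp, ← hχ]
      rfl
    · exact EV.con₃ hi' hex hq' (ih _ (EV.con₁ hi (exact_ker_subtype q) hq (EV_of_projective i) h))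
        (hfree n (i + 1))

variable {S} in
lemma exists_uniform [Module.Finite A N] (φ : N →ₗ[A] W)
    (h : ∀ n, LocalizedModule.mkLinearMap S W (φ n) = 0) : ∃ s : S, (s : A) • φ = 0 := by
  obtain ⟨s, hs⟩ := Module.Finite.exists_smul_of_comp_eq_of_isLocalizedModule S
    (LocalizedModule.mkLinearMap S W) φ 0 (LinearMap.ext fun n => by simpa using h n)
  rw [smul_zero] at hs
  exact ⟨s, hs⟩

/-- The dual localizes. -/
noncomputable def locDual (N W : Type) [AddCommGroup N] [Module A N] [AddCommGroup W] [Module A W]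
    [Module.Finite A N] : LocalizedModule S (N →ₗ[A] W) ≃ₗ[Localization S]
      (LocalizedModule S N →ₗ[Localization S] LocalizedModule S W) :=
  have := Module.finitePresentation_of_finite A N
  (IsLocalizedModule.linearEquiv S (LocalizedModule.mkLinearMap S (N →ₗ[A] W))
    (LocalizedModule.map S (M := N) (N := W))).extendScalarsOfIsLocalization S (Localization S)

lemma locDual_mk [Module.Finite A N] (f : N →ₗ[A] W) :
    locDual S N W (LocalizedModule.mkLinearMap S _ f) = LocalizedModule.map S f := by
  have := Module.finitePresentation_of_finite A N
  exact IsLocalizedModule.linearEquiv_apply S (LocalizedModule.mkLinearMap S (N →ₗ[A] W))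
    (LocalizedModule.map S (M := N) (N := W)) f

lemma exists_delta_of_loc [Module.Finite A N] [Module.Finite A W]
    (h : Function.Surjective (deltaMap (Localization S) (LocalizedModule S W)
        (LocalizedModule S N)))
    (ψ : (N →ₗ[A] W) →ₗ[A] W) : ∃ (s : S) (x : N), (s : A) • ψ = deltaMap A W N x := by
  obtain ⟨y, hy⟩ := h (LocalizedModule.map S ψ ∘ₗ (locDual S N W).symm.toLinearMap)
  induction y using LocalizedModule.induction_on with
  | h x s =>
    obtain ⟨t, ht⟩ := exists_uniform (S := S) ((s : A) • ψ - deltaMap A W N x) (by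
      intro f
      have h1 := LinearMap.congr_fun hy (LocalizedModule.map S f)
      rw [deltaMap_apply, LinearMap.comp_apply, ← locDual_mk, LinearEquiv.coe_coe,
        LinearEquiv.symm_apply_apply, locDual_mk, loc_map_mk, LocalizedModule.mkLinearMap_apply,
        loc_map_mk] at h1
      have h2 : LocalizedModule.mk ((s : A) • f x) s = LocalizedModule.mk (f x) 1 :=
        LocalizedModule.mk_cancel s (f x)
      rw [LinearMap.sub_apply, LinearMap.smul_apply, deltaMap_apply, map_sub, map_smul,
        LocalizedModule.mkLinearMap_apply, ← h1, LocalizedModule.smul'_mk, h2]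
      exact sub_self _)
    refine ⟨t * s, (t : A) • x, ?_⟩
    rw [smul_sub, sub_eq_zero] at ht
    rw [map_smul, ← ht, Submonoid.coe_mul, mul_smul]

lemma exists_smul_eq_zero_of_loc [Module.Finite A N]
    (h : Function.Injective (deltaMap (Localization S) (LocalizedModule S W) (LocalizedModule S N)))
    (x : N) (hx : deltaMap A W N x = 0) : ∃ s : S, (s : A) • x = 0 := by
  have h1 : LocalizedModule.mkLinearMap S N x = 0 := by
    apply h
    rw [map_zero]
    ext φ
    obtain ⟨f, s, hf⟩ := exists_loc_map S φ
    refine loc_smul_injective S s ?_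
    rw [deltaMap_apply, LinearMap.zero_apply, smul_zero, ← LinearMap.smul_apply, ← hf,
      LocalizedModule.mkLinearMap_apply, loc_map_mk]
    have : f x = 0 := LinearMap.congr_fun hx f
    rw [this, LocalizedModule.zero_mk]
  obtain ⟨s, hs⟩ := (IsLocalizedModule.eq_zero_iff S (LocalizedModule.mkLinearMap S N)).1 h1
  exact ⟨s, hs⟩

end localization

section heights

variable {A : Type} [CommRing A]

lemma height_add_le {d : ℕ} (hd : ringKrullDim A ≤ d) (p : PrimeSpectrum A) :
    Order.height p + Order.coheight p ≤ d := by
  have : Nonempty (PrimeSpectrum A) := ⟨p⟩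
  have h1 : ringKrullDim A = _ := Order.krullDim_eq_iSup_height_add_coheight_of_nonempty
  rw [h1] at hd
  have h2 := WithBot.coe_le_coe.1 hd
  exact (le_iSup (fun a : PrimeSpectrum A => Order.height a + Order.coheight a) p).trans h2

lemma exists_series_of_quot {I : Ideal A} (s : LTSeries (PrimeSpectrum (A ⧸ I))) :
    ∃ p : PrimeSpectrum A, I ≤ p.asIdeal ∧ (s.length : ℕ∞) ≤ Order.coheight p := by
  have hm : StrictMono (PrimeSpectrum.comap (Ideal.Quotient.mk I)) := by
    refine Monotone.strictMono_of_injective (fun a b h x hx => h hx) ?_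
    exact PrimeSpectrum.comap_injective_of_surjective _ Ideal.Quotient.mk_surjective
  refine ⟨PrimeSpectrum.comap (Ideal.Quotient.mk I) s.head, ?_, ?_⟩
  · intro x hx
    rw [PrimeSpectrum.comap_asIdeal, Ideal.mem_comap, Ideal.Quotient.eq_zero_iff_mem.2 hx]
    exact zero_mem _
  · exact Order.length_le_coheight (p := s.map _ hm) le_rfl

lemma ringKrullDim_quot_le (p : PrimeSpectrum A) :
    ringKrullDim (A ⧸ p.asIdeal) ≤ (Order.coheight p : ℕ∞) := by
  refine iSup_le fun s => ?_
  obtain ⟨q, hq, h⟩ := exists_series_of_quot s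
  have h2 : Order.coheight q ≤ Order.coheight p := Order.coheight_anti hq
  exact_mod_cast h.trans h2

lemma codGT_of_heights {d : ℕ} (hd : ringKrullDim A ≤ d) {N : Type} [AddCommGroup N] [Module A N]
    [Module.Finite A N] {n : ℕ} (h : ∀ p : PrimeSpectrum A, Order.height p ≤ n →
      ∀ x : N, ∃ s : A, s ∉ p.asIdeal ∧ s • x = 0) : codGT A d N n := by
  unfold codGT mdim
  by_cases hs : Nonempty (PrimeSpectrum (A ⧸ Module.annihilator A N))
  swap
  · rw [not_nonempty_iff] at hs
    have : ringKrullDim (A ⧸ Module.annihilator A N) = ⊥ := Order.krullDim_eq_bot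
    rw [this, WithBot.bot_add]
    exact WithBot.bot_lt_coe _
  have key : ∀ s : LTSeries (PrimeSpectrum (A ⧸ Module.annihilator A N)),
      s.length + (n + 1) ≤ d := by
    intro s
    obtain ⟨p, hp, hl⟩ := exists_series_of_quot s
    have h1 : (n + 1 : ℕ∞) ≤ Order.height p := by
      by_contra hc
      have hc' : Order.height p ≤ n := by
        rw [not_le] at hc
        exact ENat.lt_add_one_iff (ENat.natCast_ne_top n) |>.1 hc
      have hp' : p ∈ Module.support A N := by
        rw [Module.support_eq_zeroLocus]; exact hp
      obtain ⟨x, hx⟩ := Module.mem_support_iff_exists_annihilator.1 hp'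
      obtain ⟨t, ht, h0⟩ := h p hc' x
      exact ht (hx (by rwa [Submodule.mem_annihilator_span_singleton]))
    have h2 := (add_le_add h1 hl).trans (height_add_le hd p)
    have h3 : n + 1 + s.length ≤ d := by exact_mod_cast h2
    omega
  obtain ⟨s0⟩ : Nonempty (LTSeries (PrimeSpectrum (A ⧸ Module.annihilator A N))) := inferInstance
  have hd0 := key s0
  have h3 : ringKrullDim (A ⧸ Module.annihilator A N) ≤ ((d - (n + 1) : ℕ) : WithBot ℕ∞) := by
    refine iSup_le fun s => ?_
    have := key s
    have h4 : s.length ≤ d - (n + 1) := by omega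
    exact_mod_cast h4
  calc _ ≤ ((d - (n + 1) : ℕ) : WithBot ℕ∞) + n := by gcongr
    _ < d := by
      have h5 : d - (n + 1) + n < d := by omega
      exact_mod_cast h5

end heights

section quot

variable {A : Type} [CommRing A] (S : Submonoid A)

lemma exists_locQuot (J : Ideal (Localization S)) :
    Nonempty (LocalizedModule S (A ⧸ J.comap (algebraMap A (Localization S))) ≃ₗ[Localization S]
      (Localization S ⧸ J)) := by
  let I := J.comap (algebraMap A (Localization S))
  have h : Submodule.localized' (Localization S) S (Algebra.linearMap A (Localization S))
      I = J := by
    rw [Ideal.localized'_eq_map]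
    exact IsLocalization.map_under S _ J
  let q := Submodule.toLocalizedQuotient' (Localization S) S (Algebra.linearMap A (Localization S))
      I
  let e := (IsLocalizedModule.linearEquiv S (LocalizedModule.mkLinearMap S (A ⧸ I))
      q).extendScalarsOfIsLocalization S (Localization S)
  exact ⟨e.trans (Submodule.quotEquivOfEq _ _ h)⟩

end quot

section loc

variable {A : Type} [CommRing A] [IsNoetherianRing A] [IsLocalRing A]

/-- The height of a prime as a natural number. -/
noncomputable def ht (p : PrimeSpectrum A) : ℕ := (Order.height p).toNat

lemma coe_ht (p : PrimeSpectrum A) : (ht p : ℕ∞) = Order.height p := by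
  refine ENat.natCast_toNat ?_
  rw [← PrimeSpectrum.height_eq_orderHeight]
  exact Ideal.height_ne_top p.2.ne_top

lemma dim_loc (p : PrimeSpectrum A) :
    ringKrullDim (Localization.AtPrime p.asIdeal) = (ht p : ℕ) := by
  rw [IsLocalization.AtPrime.ringKrullDim_eq_height p.asIdeal, PrimeSpectrum.height_eq_orderHeight,
    ← coe_ht]
  rfl

lemma depthGE.loc {d : ℕ} (hd : ringKrullDim A ≤ d) {N : Type} [AddCommGroup N] [Module A N]
    [Module.Finite A N] (h : depthGE A d N) (p : PrimeSpectrum A) :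
    depthGE (Localization.AtPrime p.asIdeal) (ht p) (LocalizedModule p.asIdeal.primeCompl N) := by
  intro i hi
  obtain ⟨e⟩ := exists_locQuot p.asIdeal.primeCompl
    (maximalIdeal (Localization.AtPrime p.asIdeal))
  have hc : (maximalIdeal (Localization.AtPrime p.asIdeal)).comap (algebraMap A _) = p.asIdeal :=
    Localization.AtPrime.under_maximalIdeal
  refine EV.congr_left ?_ (e.trans residue_equiv.some)
  refine EV.loc _ i _ ?_
  rw [hc]
  have h1 := height_add_le hd p
  have h2 : Order.coheight p ≠ ⊤ := by
    intro h3; rw [h3, add_top] at h1; exact absurd h1 (by simp)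
  obtain ⟨c, hc'⟩ := ENat.ne_top_iff_exists.1 h2
  rw [← coe_ht, ← hc'] at h1
  have h4 : ht p + c ≤ d := by exact_mod_cast h1
  refine ischebeck h c _ ?_ i (by omega)
  rw [Module.supportDim_eq_ringKrullDim_quotient_annihilator, Ideal.annihilator_quotient]
  have := ringKrullDim_quot_le p
  rw [← hc'] at this
  exact this

lemma Good.loc {d : ℕ} {W : Type} [AddCommGroup W] [Module A W] (G : Good A W d)
    (p : PrimeSpectrum A) :
    Good (Localization.AtPrime p.asIdeal) (LocalizedModule p.asIdeal.primeCompl W) (ht p) := by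
  have := G.fin
  set S := p.asIdeal.primeCompl with hS
  have hb : EVbound (Localization.AtPrime p.asIdeal) d (LocalizedModule S W) := by
    intro N _ _ hN m hm
    refine IsNoetherianRing.induction_on_isQuotientEquivQuotientPrime _ hN
      (motive := fun N _ _ _ => EV (Localization.AtPrime p.asIdeal) m N (LocalizedModule S W))
          ?_ ?_ ?_
    · intro N _ _ _ _
      exact EV_of_subsingleton_left m
    · intro N _ _ _ P e
      obtain ⟨e'⟩ := exists_locQuot S P.asIdeal
      refine EV.congr_left ?_ (e'.trans e.symm)
      refine EV.loc _ m _ (G.nv 0 _ (fun i hi => absurd hi (by omega)) m (by omega))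
    · intro N₁ _ _ _ N₂ _ _ _ N₃ _ _ _ f g hf hg hfg h1 h3
      exact EV.con₂ hf hfg hg h1 h3
  have hb' := hb.bass (dim_loc p).le
  refine ⟨inferInstance, hb'.nv, G.depthW.loc G.dim p, ?_, (dim_loc p).le, ?_, ?_⟩
  · refine (G.depthA.loc G.dim p).congr ?_
    exact (IsLocalizedModule.linearEquiv S (LocalizedModule.mkLinearMap S A)
      (Algebra.linearMap A (Localization S))).extendScalarsOfIsLocalization S (Localization S)
  · intro r hr
    obtain ⟨a, s, rfl⟩ := IsLocalization.exists_mk'_eq S r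
    obtain ⟨t, ht⟩ := exists_uniform (S := S) (LinearMap.lsmul A W a) (by
      intro w
      have h1 := hr (LocalizedModule.mkLinearMap S W w)
      have h2 : (algebraMap A (Localization S) s) • IsLocalization.mk' (Localization S)
          a s • LocalizedModule.mkLinearMap S W w = 0 := by
        rw [h1, smul_zero]
      rw [← mul_smul, IsLocalization.mk'_spec', algebraMap_smul] at h2
      rw [LinearMap.lsmul_apply, map_smul, h2])
    have h3 : (t : A) * a = 0 := G.faithful _ (fun w => by
      rw [mul_smul]; exact LinearMap.congr_fun ht w)
    rw [IsLocalization.mk'_eq_zero_iff]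
    exact ⟨t, h3⟩
  · intro f
    obtain ⟨g, s, hg⟩ := exists_loc_map S f
    obtain ⟨r, hr⟩ := G.endo g
    refine ⟨IsLocalization.mk' (Localization S) r s, fun w => ?_⟩
    refine loc_smul_injective S s ?_
    rw [← LinearMap.smul_apply, ← hg, ← algebraMap_smul (Localization S) (s : A), ← mul_smul,
      IsLocalization.mk'_spec', algebraMap_smul]
    induction w using LocalizedModule.induction_on with
    | h m t => rw [loc_map_mk, hr, LocalizedModule.smul'_mk]

end loc

section serre

variable {A : Type} [CommRing A] [IsNoetherianRing A] [IsLocalRing A]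

/-- The depth of `N` at `p` is at least `j`. -/
def depthAt (p : PrimeSpectrum A) (j : ℕ) (N : Type) [AddCommGroup N] [Module A N] : Prop :=
  depthGE (Localization.AtPrime p.asIdeal) j (LocalizedModule p.asIdeal.primeCompl N)

lemma serreS_iff {n : ℕ} {N : Type} [AddCommGroup N] [Module A N] :
    SerreS A n N ↔ ∀ p : PrimeSpectrum A, depthAt p (min n (ht p)) N := by
  refine forall_congr' fun p => ?_
  unfold depthAt
  rw [← le_rdepth_iff, dim_loc p]
  have : min ((n : ℕ) : WithBot ℕ∞) ((ht p : ℕ) : WithBot ℕ∞) =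
      (((min n (ht p) : ℕ) : ℕ∞) : WithBot ℕ∞) := by
    rcases le_total n (ht p) with h | h
    · rw [min_eq_left h, min_eq_left (by exact_mod_cast h)]; rfl
    · rw [min_eq_right h, min_eq_right (by exact_mod_cast h)]; rfl
  rw [this, WithBot.coe_le_coe]

lemma serreS_depthAt {n : ℕ} {N : Type} [AddCommGroup N] [Module A N] (h : SerreS A n N)
    (p : PrimeSpectrum A) {j : ℕ} (h1 : j ≤ n) (h2 : j ≤ ht p) : depthAt p j N :=
  (serreS_iff.1 h p).mono (le_min h1 h2)

lemma Good.depthAt_dual {d : ℕ} {W : Type} [AddCommGroup W] [Module A W] (G : Good A W d)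
    (p : PrimeSpectrum A) (N : Type) [AddCommGroup N] [Module A N] [Module.Finite A N] {j : ℕ}
    (h1 : j ≤ 2) (h2 : j ≤ ht p) : depthAt p j (N →ₗ[A] W) := by
  have := G.fin
  exact (depthGE_dual h1 ((G.loc p).depthW.mono h2) _).congr (locDual _ N W).symm

lemma Good.serreS_dual {d : ℕ} {W : Type} [AddCommGroup W] [Module A W] (G : Good A W d)
    (N : Type) [AddCommGroup N] [Module A N] [Module.Finite A N] : SerreS A 2 (N →ₗ[A] W) :=
  serreS_iff.2 fun p => G.depthAt_dual p N (min_le_left _ _) (min_le_right _ _)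

lemma subsingleton_of_depthAt {N : Type} [AddCommGroup N] [Module A N]
    (h : ∀ p : PrimeSpectrum A, (∀ x : N, ∃ s : A, s ∉ p.asIdeal ∧ s • x = 0) ∨ depthAt p 1 N) :
    Subsingleton N := by
  by_contra hc
  rw [not_subsingleton_iff_nontrivial] at hc
  obtain ⟨P, hP⟩ := associatedPrimes.nonempty A N
  obtain ⟨hprime, f, hf⟩ := (isAssociatedPrime_iff_exists_injective_linearMap P N).1 hP
  let p : PrimeSpectrum A := ⟨P, hprime⟩
  let x : N := f (Submodule.Quotient.mk 1)
  have h_ann : ∀ a : A, a ∈ p.asIdeal ↔ a • x = 0 := by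
    intro a
    rw [← map_smul, ← Submodule.Quotient.mk_smul, smul_eq_mul, mul_one,
      map_eq_zero_iff f hf, Submodule.Quotient.mk_eq_zero]
  have key : ∃ s : A, s ∉ p.asIdeal ∧ s • x = 0 := by
    rcases h p with h1 | h1
    · exact h1 x
    · have h2 := EV_zero_iff.1 ((h1 0 one_pos).congr_left residue_equiv.some.symm)
      let g : Localization.AtPrime p.asIdeal →ₗ[Localization.AtPrime p.asIdeal]
          LocalizedModule p.asIdeal.primeCompl N :=
        LinearMap.toSpanSingleton _ _ (LocalizedModule.mkLinearMap _ N x)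
      have hg : maximalIdeal (Localization.AtPrime p.asIdeal) ≤ LinearMap.ker g := by
        rw [← Localization.AtPrime.map_eq_maximalIdeal, Ideal.map_le_iff_le_comap]
        intro a ha
        rw [Ideal.mem_comap, LinearMap.mem_ker, LinearMap.toSpanSingleton_apply, algebraMap_smul,
          ← map_smul, (h_ann a).1 ha, map_zero]
      have h3 := LinearMap.congr_fun (h2 (Submodule.liftQ _ g hg)) (Submodule.Quotient.mk 1)
      rw [Submodule.liftQ_apply, LinearMap.toSpanSingleton_apply, one_smul,
          LinearMap.zero_apply] at h3
      obtain ⟨s, hs⟩ := (IsLocalizedModule.eq_zero_iff p.asIdeal.primeCompl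
        (LocalizedModule.mkLinearMap _ N)).1 h3
      exact ⟨s, s.2, hs⟩
  obtain ⟨s, hs, h0⟩ := key
  exact hs ((h_ann s).2 h0)

variable {d : ℕ} {ω : Type} [AddCommGroup ω] [Module A ω]

lemma exists_extend_of_loc {L F T : Type} [AddCommGroup L] [Module A L] [AddCommGroup F]
    [Module A F]
    [AddCommGroup T] [Module A T] [Module.Finite A L] [Module.Finite A F]
    {f : L →ₗ[A] F} {g : F →ₗ[A] T} (hf : Function.Injective f) (hfg : Function.Exact f g)
    (hg : Function.Surjective g) (S : Submonoid A)
    (h : EV (Localization S) 1 (LocalizedModule S T) (LocalizedModule S ω)) (φ : L →ₗ[A] ω) :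
    ∃ (s : S) (ψ : F →ₗ[A] ω), dmap A ω f ψ = (s : A) • φ := by
  obtain ⟨Ψ, hΨ⟩ := EV.exists_extend (LocalizedModule.map_injective S _ hf) (loc_exact S hfg)
    (LocalizedModule.map_surjective S _ hg) h (LocalizedModule.map S φ)
  obtain ⟨ψ, s, hψ⟩ := exists_loc_map S Ψ
  obtain ⟨t, ht⟩ := exists_uniform (S := S) (ψ ∘ₗ f - (s : A) • φ) (by
    intro x
    have h1 := LinearMap.congr_fun hΨ (LocalizedModule.mkLinearMap S L x)
    have h2 := LinearMap.congr_fun hψ (LocalizedModule.map S f (LocalizedModule.mkLinearMap S L x))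
    rw [LinearMap.comp_apply] at h1
    rw [LinearMap.smul_apply, h1, LocalizedModule.mkLinearMap_apply,
      loc_map_mk, loc_map_mk, loc_map_mk] at h2
    rw [LinearMap.sub_apply, LinearMap.smul_apply, map_sub, map_smul, LinearMap.comp_apply,
      LocalizedModule.mkLinearMap_apply, LocalizedModule.mkLinearMap_apply, h2, sub_self])
  refine ⟨t * s, (t : A) • ψ, ?_⟩
  rw [smul_sub, sub_eq_zero] at ht
  rw [map_smul, Submonoid.coe_mul, mul_smul, ← ht]
  rfl

lemma Good.ev_one_of_serreS (G : Good A ω d) {T : Type} [AddCommGroup T] [Module A T]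
    [Module.Finite A T] (hT : SerreS A 2 T) (hT' : SerreS A 3 (T →ₗ[A] ω)) : EV A 1 T ω := by
  have := G.fin
  obtain ⟨n, q, hq⟩ := Module.Finite.exists_fin' A T
  let ι := (LinearMap.ker q).subtype
  have hι : Function.Injective ι := Subtype.val_injective
  have hex := exact_ker_subtype q
  let j := dmap A ω ι
  have : Subsingleton (_ ⧸ LinearMap.range j) := by
    refine subsingleton_of_depthAt (A := A) fun p => ?_
    rcases Nat.lt_or_ge (ht p) 3 with h | h
    · left
      intro y
      obtain ⟨φ, rfl⟩ := Submodule.Quotient.mk_surjective _ y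
      obtain ⟨s, ψ, hs⟩ := exists_extend_of_loc hι hex hq p.asIdeal.primeCompl
        ((G.loc p).ev_one (serreS_depthAt hT p (by omega) le_rfl)) φ
      refine ⟨s, s.2, ?_⟩
      rw [← Submodule.Quotient.mk_smul, ← hs]
      exact (Submodule.Quotient.mk_eq_zero _).2 ⟨ψ, rfl⟩
    · right
      have h1 := serreS_depthAt hT' p le_rfl h
      have h2 := G.depthAt_dual p (Fin n → A) (by omega : 2 ≤ 2) (by omega)
      have h3 := G.depthAt_dual p (LinearMap.ker q) (by omega : 1 ≤ 2) (by omega)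
      have h4 : EV (Localization.AtPrime p.asIdeal) 1
          (ResidueField (Localization.AtPrime p.asIdeal))
          (LocalizedModule p.asIdeal.primeCompl (LinearMap.range j)) := by
        have hex' : Function.Exact (dmap A ω q) j.rangeRestrict := by
          intro y
          rw [← dmap_exact ω hex hq y]
          exact ⟨fun h => congrArg Subtype.val h, fun h => Subtype.ext h⟩
        exact EV.cov₃ (LocalizedModule.map_injective _ _ (dmap_injective ω hq)) (loc_exact _ hex')
          (LocalizedModule.map_surjective _ _ (LinearMap.surjective_rangeRestrict j))
          (h2 1 (by omega)) (h1 2 (by omega))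
      intro i hi
      obtain rfl : i = 0 := by omega
      exact EV.cov₃ (LocalizedModule.map_injective _ _ (Submodule.subtype_injective _))
        (loc_exact _ (exact_subtype_mkQ (LinearMap.range j)))
        (LocalizedModule.map_surjective _ _ (Submodule.mkQ_surjective _)) (h3 0 (by omega)) h4
  have hj : Function.Surjective j :=
    LinearMap.range_eq_top.1 (Submodule.Quotient.subsingleton_iff.1 this)
  exact EV_one_of_extend hι hex hq (fun φ => hj φ) (EV_of_projective 0)

lemma Good.codGT_ker_delta (G : Good A ω d) {C : Type} [AddCommGroup C] [Module A C]
    [Module.Finite A C] (hC : EV A 1 C ω) : codGT A d (LinearMap.ker (deltaMap A ω C)) 1 := by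
  refine codGT_of_heights G.dim fun p hp x => ?_
  have hp' : ht p ≤ 1 := by rw [← coe_ht] at hp; exact_mod_cast hp
  obtain ⟨s, hs⟩ := exists_smul_eq_zero_of_loc p.asIdeal.primeCompl
    ((G.loc p).delta_injective_of_le_one hp' (EV.loc _ 1 _ hC)) x.1 x.2
  exact ⟨s, s.2, Subtype.ext hs⟩

lemma Good.codGT_coker_delta (G : Good A ω d) {C : Type} [AddCommGroup C] [Module A C]
    [Module.Finite A C] (hC : EV A 1 C ω) :
    codGT A d (((C →ₗ[A] ω) →ₗ[A] ω) ⧸ LinearMap.range (deltaMap A ω C)) 2 := by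
  have := G.fin
  have := G.finite_dual C
  refine codGT_of_heights G.dim fun p hp y => ?_
  have hp' : ht p ≤ 2 := by rw [← coe_ht] at hp; exact_mod_cast hp
  obtain ⟨ψ, rfl⟩ := Submodule.Quotient.mk_surjective _ y
  obtain ⟨s, x, hs⟩ := exists_delta_of_loc p.asIdeal.primeCompl
    ((G.loc p).delta_surjective_of_le_two hp' (EV.loc _ 1 _ hC)) ψ
  refine ⟨s, s.2, ?_⟩
  rw [← Submodule.Quotient.mk_smul, hs]
  exact (Submodule.Quotient.mk_eq_zero _).2 ⟨x, rfl⟩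

lemma Good.serreS_three (G : Good A ω d) {C X M : Type} [AddCommGroup C] [Module A C]
    [AddCommGroup X] [Module A X] [AddCommGroup M] [Module A M] [Module.Finite A C]
        [Module.Finite A X]
    [Module.Finite A M] (hX : depthGE A d X) {f : M →ₗ[A] X} {g : X →ₗ[A] C}
    (hfg : Function.Exact f g) (hg : Function.Surjective g)
    (hf : Function.Surjective (dmap A ω f)) : SerreS A 3 (C →ₗ[A] ω) := by
  have := G.fin
  rw [serreS_iff]
  intro p
  have hX' := ((G.mcm_dual hX).loc G.dim p)
  obtain hh | ⟨j, hj⟩ : ht p = 0 ∨ ∃ j, min 3 (ht p) = j + 1 := by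
    rcases Nat.eq_zero_or_pos (ht p) with h | h
    · exact Or.inl h
    · exact Or.inr ⟨min 3 (ht p) - 1, by omega⟩
  · intro i hi; omega
  rw [hj]
  exact depthGE.ker (LocalizedModule.map_injective _ _ (dmap_injective ω hg))
    (loc_exact _ (dmap_exact ω hfg hg)) (LocalizedModule.map_surjective _ _ hf)
    (hX'.mono (by omega)) (G.depthAt_dual p M (by omega) (by omega))

section fourTerm

variable {S C T U : Type} [AddCommGroup S] [Module A S] [AddCommGroup C] [Module A C]
  [AddCommGroup T] [Module A T] [AddCommGroup U] [Module A U]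
  [Module.Finite A S] [Module.Finite A C] [Module.Finite A T] [Module.Finite A U]
  {a : S →ₗ[A] C} {u : C →ₗ[A] T} {c : T →ₗ[A] U}

lemma exact_rangeRestrict (hau : Function.Exact a u) : Function.Exact a u.rangeRestrict := by
  intro y
  rw [← hau y]
  exact ⟨fun h => congrArg Subtype.val h, fun h => Subtype.ext h⟩

lemma exact_range_subtype (huc : Function.Exact u c) :
    Function.Exact (LinearMap.range u).subtype c := by
  intro y
  rw [huc y]
  exact ⟨fun ⟨x, hx⟩ => ⟨⟨y, x, hx⟩, rfl⟩, fun ⟨⟨_, x, hx⟩, hy⟩ => ⟨x, hx.trans hy⟩⟩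

/-- `u` dualizes to an isomorphism. -/
lemma Good.dmap_bijective (G : Good A ω d) (hau : Function.Exact a u) (huc : Function.Exact u c)
    (hc : Function.Surjective c) (hS : codGT A d S 0) (hU : codGT A d U 1) :
    Function.Bijective (dmap A ω u) := by
  have := G.fin
  have hd := G.depthW
  have h1 := dmap_injective ω u.surjective_rangeRestrict
  have e1 := dmap_exact ω (exact_rangeRestrict hau) u.surjective_rangeRestrict
  have hsub : Function.Injective (LinearMap.range u).subtype := Subtype.val_injective
  have e2 := dmap_exact ω (exact_range_subtype huc) hc
  have hS0 := EV_zero_iff.1 (EV_of_codGT hd hS (Nat.le_refl 0))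
  have hU0 := EV_zero_iff.1 (EV_of_codGT hd hU (Nat.zero_le 1))
  have s2 : Function.Surjective (dmap A ω (LinearMap.range u).subtype) :=
    dmap_surjective hsub (exact_range_subtype huc) hc (EV_of_codGT hd hU le_rfl)
  have hcomp : ∀ φ, dmap A ω u φ = dmap A ω u.rangeRestrict
      (dmap A ω (LinearMap.range u).subtype φ) :=
    fun _ => rfl
  constructor
  · rw [injective_iff_map_eq_zero]
    intro φ hφ
    rw [hcomp] at hφ
    obtain ⟨y, hy⟩ := (e2 φ).1 (h1 (hφ.trans (map_zero _).symm))
    rw [← hy, hU0 y, map_zero]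
  · intro φ
    obtain ⟨y, hy⟩ := (e1 φ).1 (hS0 _)
    obtain ⟨z, rfl⟩ := s2 y
    exact ⟨z, hy⟩

lemma Good.ev_one_fourTerm (G : Good A ω d) (ha : Function.Injective a) (hau : Function.Exact a u)
    (huc : Function.Exact u c)
    (hc : Function.Surjective c) (hS : codGT A d S 1) (hU : codGT A d U 2) (hT : EV A 1 T ω) :
    EV A 1 C ω := by
  have := G.fin
  have hd := G.depthW
  have h1 : EV A 1 (LinearMap.range u) ω := EV.con₁ (f := (LinearMap.range u).subtype)
    Subtype.val_injective (exact_range_subtype huc) hc hT (EV_of_codGT hd hU le_rfl)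
  exact EV.con₂ ha (exact_rangeRestrict hau) u.surjective_rangeRestrict
    (EV_of_codGT hd hS le_rfl) h1

end fourTerm

end serre

section bound

variable {A : Type} [CommRing A] {Y Y' : Type} [AddCommGroup Y] [Module A Y] [AddCommGroup Y']
    [Module A Y']

lemma EVbound.retract {n : ℕ} (h : EVbound A n Y) (s : Y' →ₗ[A] Y) (r : Y →ₗ[A] Y')
    (hrs : r ∘ₗ s = LinearMap.id) : EVbound A n Y' :=
  fun N _ _ _ m hm => (h N m hm).retract_right s r hrs

end bound

section backward

variable {A : Type} [CommRing A] [IsNoetherianRing A] [IsLocalRing A]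
variable {d : ℕ} {ω : Type} [AddCommGroup ω] [Module A ω]

lemma isMCM_iff {Z : Type} [AddCommGroup Z] [Module A Z] :
    IsMCM A d Z ↔ Module.Finite A Z ∧ depthGE A d Z := by
  unfold IsMCM
  rw [le_rdepth_iff]

lemma EVbound.ev_one (G : Good A ω d) {Y Z : Type} [AddCommGroup Y] [Module A Y] [AddCommGroup Z]
    [Module A Z] [Module.Finite A Y] [Module.Finite A Z] {n : ℕ} (hY : EVbound A n Y)
    (hZ : depthGE A d Z) : EV A 1 Z Y :=
  (hY.bass G.dim).nv d Z hZ 1 (by omega)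

/-- A map of dual modules comes from a map of reflexive modules. -/
lemma exists_dmap_eq {X Z : Type} [AddCommGroup X] [Module A X] [AddCommGroup Z] [Module A Z]
    (hZ : Function.Bijective (deltaMap A ω Z)) (h : (Z →ₗ[A] ω) →ₗ[A] (X →ₗ[A] ω)) :
    ∃ g : X →ₗ[A] Z, dmap A ω g = h := by
  let e := LinearEquiv.ofBijective _ hZ
  refine ⟨e.symm.toLinearMap ∘ₗ dmap A ω h ∘ₗ deltaMap A ω X, ?_⟩
  ext ζ x
  have h1 : deltaMap A ω Z (e.symm (dmap A ω h (deltaMap A ω X x))) = dmap A ω h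
      (deltaMap A ω X x) :=
    e.apply_symm_apply _
  exact LinearMap.congr_fun h1 ζ

lemma dmap_injective_hom {X Z : Type} [AddCommGroup X] [Module A X] [AddCommGroup Z] [Module A Z]
    (hZ : Function.Injective (deltaMap A ω Z)) {f g : X →ₗ[A] Z} (h : dmap A ω f = dmap A ω g) :
        f = g := by
  ext x
  apply hZ
  ext ζ
  exact LinearMap.congr_fun (LinearMap.congr_fun h ζ) x

lemma dmap_comp {X Y Z : Type} [AddCommGroup X] [Module A X] [AddCommGroup Z] [Module A Z]
    [AddCommGroup Y] [Module A Y] (f : X →ₗ[A] Y) (g : Y →ₗ[A] Z) :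
    dmap A ω (g ∘ₗ f) = dmap A ω f ∘ₗ dmap A ω g := rfl

variable {M X : Type} [AddCommGroup M] [Module A M] [AddCommGroup X] [Module A X] {μ : M →ₗ[A] X}
  [Module.Finite A M] [Module.Finite A X]

lemma Good.dmap_surjective_of_coker (G : Good A ω d) (hK : codGT A d (LinearMap.ker μ) 0)
    (hC : EV A 1 (X ⧸ LinearMap.range μ) ω) : Function.Surjective (dmap A ω μ) := by
  have := G.fin
  intro φ
  have h0 := EV_zero_iff.1 (EV_of_codGT G.depthW hK le_rfl)
  obtain ⟨ψ, rfl⟩ := (dmap_exact ω (exact_rangeRestrict (exact_ker_subtype μ))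
    μ.surjective_rangeRestrict φ).1 (h0 _)
  obtain ⟨χ, hχ⟩ := EV.exists_extend (f := (LinearMap.range μ).subtype) Subtype.val_injective
    (exact_subtype_mkQ _) (Submodule.mkQ_surjective _) hC ψ
  exact ⟨χ, by rw [← hχ]; rfl⟩

lemma Good.preenvelope (G : Good A ω d) (hX : depthGE A d X) (hμ : Function.Surjective (dmap A ω μ))
    {n : ℕ} (hC : EVbound A n ((X ⧸ LinearMap.range μ) →ₗ[A] ω)) : IsCMPreenvelope A d μ := by
  have := G.fin
  refine ⟨isMCM_iff.2 ⟨inferInstance, hX⟩, fun Z _ _ hZ f => ?_⟩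
  obtain ⟨_, hZ⟩ := isMCM_iff.1 hZ
  have hY := hC.ev_one G (G.mcm_dual hZ)
  obtain ⟨h, hh⟩ := EV.exists_lift (dmap_injective ω (Submodule.mkQ_surjective (LinearMap.range μ)))
    (dmap_exact ω (LinearMap.exact_map_mkQ_range μ) (Submodule.mkQ_surjective _)) hμ hY (dmap A ω f)
  obtain ⟨g, rfl⟩ := exists_dmap_eq (G.delta_bijective hZ) h
  exact ⟨g, dmap_injective_hom (G.delta_bijective hZ).1 hh⟩

/-- A maximal Cohen-Macaulay module whose dual has finite injective dimension is free. -/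
lemma Good.free_of_bound (G : Good A ω d) {Z : Type} [AddCommGroup Z] [Module A Z]
    [Module.Finite A Z]
    (hZ : depthGE A d Z) {n : ℕ} (hb : EVbound A n (Z →ₗ[A] ω)) : Module.Free A Z := by
  have := G.fin
  obtain ⟨m, q, hq⟩ := Module.Finite.exists_fin' A Z
  have hL := depthGE.ker' (f := (LinearMap.ker q).subtype) Subtype.val_injective
      (exact_ker_subtype q) hq (G.depth_free m) hZ
  obtain ⟨ρ, hρ⟩ := EV.exists_extend (dmap_injective ω hq) (dmap_exact ω (exact_ker_subtype q) hq)
    (dmap_surjective (f := (LinearMap.ker q).subtype) Subtype.val_injective (exact_ker_subtype q) hq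
      (G.ev_one hZ)) (hb.ev_one G (G.mcm_dual hL)) LinearMap.id
  obtain ⟨σ, rfl⟩ := exists_dmap_eq ⟨G.delta_free_injective m, G.delta_free_surjective m⟩ ρ
  have h1 : q ∘ₗ σ = LinearMap.id := dmap_injective_hom (G.delta_bijective hZ).1 hρ
  have : Module.Projective A Z := Module.Projective.of_split σ q h1
  exact Module.free_of_flat_of_isLocalRing

lemma Good.subsingleton_of_retract (G : Good A ω d) (hX : depthGE A d X)
    {n : ℕ} (hC : EVbound A n ((X ⧸ LinearMap.range μ) →ₗ[A] ω))
    {S T : Type} [AddCommGroup S] [Module A S] [AddCommGroup T] [Module A T] [Module.Finite A S]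
    [Module.Finite A T]
    {a : S →ₗ[A] (X ⧸ LinearMap.range μ)} {u : (X ⧸ LinearMap.range μ) →ₗ[A] T}
    (hau : Function.Exact a u) (hS : codGT A d S 0)
    (hu : NoNonzeroFreeSummand A (LinearMap.range u))
    {Z : Type} [AddCommGroup Z] [Module A Z] (s : Z →ₗ[A] X) (r : X →ₗ[A] Z)
    (hrs : r ∘ₗ s = LinearMap.id) (hrμ : r ∘ₗ μ = 0) : Subsingleton Z := by
  have hr : Function.Surjective r := fun z => ⟨s z, LinearMap.congr_fun hrs z⟩
  have : Module.Finite A Z := Module.Finite.of_surjective r hr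
  have hZ : depthGE A d Z := hX.retract s r hrs
  let r' : (X ⧸ LinearMap.range μ) →ₗ[A] Z := (LinearMap.range μ).liftQ r (by
    rintro _ ⟨m, rfl⟩
    exact LinearMap.congr_fun hrμ m)
  have hr' : r' ∘ₗ (LinearMap.range μ).mkQ = r := Submodule.liftQ_mkQ _ _ _
  have h1 : r' ∘ₗ ((LinearMap.range μ).mkQ ∘ₗ s) = LinearMap.id := by
    rw [← LinearMap.comp_assoc, hr', hrs]
  have hfree : Module.Free A Z := G.free_of_bound hZ (hC.retract (dmap A ω r')
    (dmap A ω ((LinearMap.range μ).mkQ ∘ₗ s)) (by rw [← dmap_comp, h1]; rfl))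
  have h2 : r' ∘ₗ a = 0 := EV_zero_iff.1 (EV_of_codGT hZ hS le_rfl) _
  let r'' : LinearMap.range u →ₗ[A] Z := desc u.rangeRestrict u.surjective_rangeRestrict r' (by
    intro x hx
    obtain ⟨y, rfl⟩ := (exact_rangeRestrict hau x).1 hx
    exact LinearMap.congr_fun h2 y)
  let s'' : Z →ₗ[A] LinearMap.range u := u.rangeRestrict ∘ₗ ((LinearMap.range μ).mkQ ∘ₗ s)
  have h3 : ∀ z, r'' (s'' z) = z := by
    intro z
    simp only [r'', s'', LinearMap.comp_apply (f := u.rangeRestrict), desc_apply]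
    exact LinearMap.congr_fun h1 z
  have hinj : Function.Injective s'' := Function.LeftInverse.injective h3
  have hcompl : IsCompl (LinearMap.range s'') (LinearMap.ker r'') := by
    refine IsCompl.of_eq ?_ ?_
    · rw [eq_bot_iff]
      rintro _ ⟨⟨z, rfl⟩, h⟩
      have h' : r'' (s'' z) = 0 := h
      rw [h3] at h'
      rw [h', map_zero]; exact zero_mem _
    · rw [eq_top_iff]
      intro x _
      rw [← sub_add_cancel x (s'' (r'' x)), add_comm]
      refine Submodule.add_mem_sup ⟨_, rfl⟩ ?_
      rw [LinearMap.mem_ker, map_sub, h3, sub_self]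
  have h4 := hu _ _ hcompl (Module.Free.of_equiv (LinearEquiv.ofInjective s'' hinj))
  refine ⟨fun x y => hinj ?_⟩
  have h5 : s'' = 0 := LinearMap.range_eq_bot.1 h4
  rw [h5]; rfl

end backward

section Henselian
open Polynomial

variable {R : Type} [CommRing R] [HenselianLocalRing R]

lemma exists_etale_section {S : Type} [CommRing S] [Algebra R S] [Algebra.Etale R S]
    (γ : S →ₐ[R] ResidueField R) :
    ∃ σ : S →ₐ[R] R, (Algebra.ofId R (ResidueField R)).comp σ = γ := by
  have hQ : (RingHom.ker γ.toRingHom).IsPrime := RingHom.ker_isPrime _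
  obtain ⟨f, hf, hstd⟩ := Algebra.IsEtaleAt.exists_isStandardEtale (R := R)
    (RingHom.ker γ.toRingHom)
  have hu : IsUnit (γ f) := isUnit_iff_ne_zero.mpr (fun h => hf h)
  let γ' : Localization.Away f →ₐ[R] ResidueField R := IsLocalization.Away.liftAlgHom (f := γ) f hu
  have hγ' : γ'.comp (IsScalarTower.toAlgHom R S (Localization.Away f)) = γ := by
    ext x; simp [γ']
  obtain ⟨P⟩ := hstd.nonempty_standardEtalePresentation
  have hm : P.HasMap (γ' P.x) := by
    have := (StandardEtalePair.hasMap_X (P := P.P)).map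
      (γ'.comp P.equivRing.symm.toAlgHom)
    simpa using this
  obtain ⟨a, ha, hra⟩ := (((HenselianLocalRing.TFAE R).out 0 1).mp ‹_› :)
    P.f P.monic_f
    (γ' P.x) hm.1 hm.isUnit_derivative_f.ne_zero
  have hga : P.HasMap a := by
    refine ⟨by simpa [coe_aeval_eq_eval] using ha, ?_⟩
    have : IsUnit (IsLocalRing.residue R (aeval a P.g)) := by
      have h2 := hm.2
      rw [← hra] at h2
      have : aeval (IsLocalRing.residue R a) P.g = IsLocalRing.residue R (aeval a P.g) :=
        aeval_algebraMap_apply (ResidueField R) a P.g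
      rwa [this] at h2
    exact (isUnit_map_iff (IsLocalRing.residue R) _).mp this
  refine ⟨((P.lift a hga).comp P.equivRing.toAlgHom).comp (IsScalarTower.toAlgHom R S _), ?_⟩
  rw [← hγ', ← AlgHom.comp_assoc]
  congr 1
  apply P.hom_ext
  simpa using hra

lemma exists_coprime_factorization {p : R[X]} (hp : p.Monic) :
    ∃ g h : R[X], ∃ n : ℕ, g.Monic ∧ h.Monic ∧ p = g * h ∧ IsCoprime g h ∧
      g.map (IsLocalRing.residue R) = X ^ n ∧ IsUnit (h.eval 0) := by
  classical
  set q := p.map (IsLocalRing.residue R) with hq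
  have hqm : q.Monic := hp.map _
  set n := q.rootMultiplicity 0
  obtain ⟨h₀, hh₀, hnd⟩ := exists_eq_pow_rootMultiplicity_mul_and_not_dvd q hqm.ne_zero 0
  simp only [map_zero, sub_zero] at hh₀ hnd
  change q = X ^ n * h₀ at hh₀
  have hh₀m : h₀.Monic := (monic_X_pow n).of_mul_monic_left (hh₀ ▸ hqm)
  have hcop : IsCoprime (X ^ n : (ResidueField R)[X]) h₀ :=
    IsCoprime.pow_left ((irreducible_X.coprime_iff_not_dvd).mpr hnd)
  have hdeg : p.natDegree = n + h₀.natDegree := by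
    rw [← hp.natDegree_map (IsLocalRing.residue R), ← hq, hh₀,
      (monic_X_pow n).natDegree_mul hh₀m, natDegree_X_pow]
  let P : MonicDegreeEq R p.natDegree := .mk p hp rfl
  let γ := (UniversalCoprimeFactorizationRing.homEquiv (ResidueField R) n h₀.natDegree hdeg P).symm
    ⟨(.mk (X ^ n) (monic_X_pow n) (natDegree_X_pow n), .mk h₀ hh₀m rfl), hh₀.symm, hcop⟩
  obtain ⟨σ, hσ⟩ := exists_etale_section γ
  set r := UniversalCoprimeFactorizationRing.homEquiv R n h₀.natDegree hdeg P σ with hr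
  have h1 := UniversalCoprimeFactorizationRing.homEquiv_comp_fst R n h₀.natDegree hdeg P σ
    (Algebra.ofId R (ResidueField R))
  have h2 := UniversalCoprimeFactorizationRing.homEquiv_comp_snd R n h₀.natDegree hdeg P σ
    (Algebra.ofId R (ResidueField R))
  rw [hσ, Equiv.apply_symm_apply] at h1 h2
  have h1' : (X ^ n : (ResidueField R)[X]) = r.1.1.1.map (IsLocalRing.residue R) :=
    congrArg Subtype.val h1
  have h2' : h₀ = r.1.2.1.map (IsLocalRing.residue R) := congrArg Subtype.val h2
  refine ⟨r.1.1.1, r.1.2.1, n, r.1.1.monic, r.1.2.monic, ?_, r.2.2, h1'.symm, ?_⟩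
  · simpa [P] using! r.2.1.symm
  · rw [← isUnit_map_iff (IsLocalRing.residue R), isUnit_iff_ne_zero]
    intro h0
    apply hnd
    rw [X_dvd_iff, coeff_zero_eq_eval_zero, h2']
    simpa [eval_map, eval₂_at_zero, coeff_zero_eq_eval_zero] using h0

variable {X : Type} [AddCommGroup X] [Module R X] [Module.Finite R X]

lemma bijective_of_retract_trivial {M : Type} [AddCommGroup M] [Module R M] {μ : M →ₗ[R] X}
    {φ : X →ₗ[R] X} (hφ : φ ∘ₗ μ = μ)
    (H : ∀ (Z : Submodule R X) (r : X →ₗ[R] Z), r ∘ₗ Z.subtype = LinearMap.id → r ∘ₗ μ = 0 →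
      Subsingleton Z) : Function.Bijective φ := by
  obtain ⟨p, hp, hpφ⟩ := LinearMap.exists_monic_and_aeval_eq_zero R φ
  obtain ⟨g, h, n, hg, hh, rfl, ⟨a, b, hab⟩, hgn, h0⟩ := exists_coprime_factorization hp
  have hg1 : IsUnit (g.eval 1) := by
    rw [← isUnit_map_iff (IsLocalRing.residue R), ← eval₂_at_one, ← Polynomial.eval_map, hgn]
    simp
  have hmul (u v : R[X]) (x : X) : aeval φ (u * v) x = aeval φ u (aeval φ v x) := by
    rw [map_mul]; rfl
  have hsum (x : X) : aeval φ (a * g) x + aeval φ (b * h) x = x := by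
    rw [← LinearMap.add_apply, ← map_add, hab]; simp
  have hgh (x : X) : aeval φ g (aeval φ h x) = 0 := by
    rw [← hmul, hpφ]; rfl
  have hX (x : X) : aeval φ (Polynomial.X : R[X]) x = φ x := by simp
  set Z := LinearMap.ker (aeval φ g)
  let r : X →ₗ[R] Z := (aeval φ (b * h)).codRestrict Z (fun x => by
    rw [LinearMap.mem_ker, mul_comm b, ← hmul, ← mul_assoc, hmul, hmul, hgh])
  have hr (x : X) : (r x : X) = aeval φ (b * h) x := rfl
  have hZ : Subsingleton Z := by
    refine H Z r ?_ ?_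
    · ext z
      have := hsum z
      rw [hmul a g, LinearMap.mem_ker.mp z.2, map_zero, zero_add] at this
      simpa [hr] using this
    · ext m
      obtain ⟨q, hq⟩ : (Polynomial.X - C 1 : R[X]) ∣ g - C (g.eval 1) :=
        X_sub_C_dvd_sub_C_eval
      have hz : aeval φ g (r (μ m) : X) = 0 := (r (μ m)).2
      have h1 : aeval φ (Polynomial.X - C 1 : R[X]) (r (μ m) : X) = 0 := by
        rw [hr, ← hmul, mul_comm, hmul]
        have : aeval φ (Polynomial.X - C 1 : R[X]) (μ m) = 0 := by
          have := LinearMap.congr_fun hφ m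
          simp only [LinearMap.comp_apply] at this
          simp [this]
        rw [this, map_zero]
      have h2 : aeval φ (g - C (g.eval 1)) (r (μ m) : X) = 0 := by
        rw [hq, mul_comm, hmul, h1, map_zero]
      rw [map_sub, LinearMap.sub_apply, hz, zero_sub, neg_eq_zero, aeval_C] at h2
      exact (hg1.smul_eq_zero (x := (r (μ m) : X))).mp h2
  have hhφ (x : X) : aeval φ h x = 0 :=
    congrArg Subtype.val (Subsingleton.elim (⟨_, hgh x⟩ : Z) 0)
  obtain ⟨q, hq⟩ : (Polynomial.X - C 0 : R[X]) ∣ h - C (h.eval 0) := X_sub_C_dvd_sub_C_eval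
  simp only [map_zero, sub_zero] at hq
  have hq' (x : X) : φ (aeval φ q x) = - (h.eval 0 • x) := by
    have := congrArg (fun t => aeval φ t x) hq
    simp only [map_sub, LinearMap.sub_apply, hhφ, hmul, hX, aeval_C] at this
    simpa using this.symm
  have hsurj : Function.Surjective φ := fun y => by
    obtain ⟨u, hu⟩ := h0
    refine ⟨- aeval φ q ((↑u⁻¹ : R) • y), ?_⟩
    rw [map_neg, hq', ← hu, neg_neg, smul_smul]; simp
  exact ⟨OrzechProperty.injective_of_surjective_endomorphism φ hsurj, hsurj⟩
end Henselian

lemma codGT_mono {A : Type} [CommRing A] {d : ℕ} {N : Type} [AddCommGroup N] [Module A N] {m n : ℕ}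
    (hmn : m ≤ n) (h : codGT A d N n) : codGT A d N m := by
  refine lt_of_le_of_lt ?_ h
  gcongr

section forward

variable {A : Type} [CommRing A] [IsNoetherianRing A] [HenselianLocalRing A]
variable {d : ℕ} {ω : Type} [AddCommGroup ω] [Module A ω]
variable {M X : Type} [AddCommGroup M] [Module A M] [AddCommGroup X] [Module A X] {μ : M →ₗ[A] X}
  [Module.Finite A M] [Module.Finite A X]

lemma Good.isCMEnvelope_of_exact (G : Good A ω d) (hX : depthGE A d X)
    (hK : codGT A d (LinearMap.ker μ) 0)
    {S T U : Type} [AddCommGroup S] [Module A S] [AddCommGroup T] [Module A T] [AddCommGroup U]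
    [Module A U] [Module.Finite A S] [Module.Finite A T] [Module.Finite A U]
    {a : S →ₗ[A] (X ⧸ LinearMap.range μ)} {u : (X ⧸ LinearMap.range μ) →ₗ[A] T} {c : T →ₗ[A] U}
    (ha : Function.Injective a) (hau : Function.Exact a u) (huc : Function.Exact u c)
    (hc : Function.Surjective c) (hS : codGT A d S 1) (hU : codGT A d U 2)
    (hT : SerreS A 2 T) (hid : HasFID A (T →ₗ[A] ω)) (hT' : SerreS A 3 (T →ₗ[A] ω))
    (hu : NoNonzeroFreeSummand A (LinearMap.range u)) : IsCMEnvelope A d μ := by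
  have hS0 := codGT_mono (Nat.zero_le 1) hS
  have hC1 := G.ev_one_fourTerm ha hau huc hc hS hU (G.ev_one_of_serreS hT hT')
  have hμ := G.dmap_surjective_of_coker hK hC1
  have hbij := G.dmap_bijective hau huc hc hS0 (codGT_mono one_le_two hU)
  let e := LinearEquiv.ofBijective _ hbij
  obtain ⟨n, hn⟩ := EVbound_of_hasFID hid
  have hC : EVbound A n ((X ⧸ LinearMap.range μ) →ₗ[A] ω) :=
    hn.retract e.symm.toLinearMap e.toLinearMap (by ext1 x; exact e.apply_symm_apply x)
  refine ⟨G.preenvelope hX hμ hC, fun φ hφ => bijective_of_retract_trivial hφ fun Z r hr hrμ => ?_⟩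
  exact G.subsingleton_of_retract hX hC hau hS0 hu Z.subtype r hr hrμ

end forward

section hasFID

variable {A : Type} [CommRing A]
variable {M₁ M₂ M₃ Y Y' : Type} [AddCommGroup Y] [Module A Y] [AddCommGroup Y'] [Module A Y']
  [AddCommGroup M₁] [Module A M₁] [AddCommGroup M₂] [Module A M₂] [AddCommGroup M₃] [Module A M₃]

lemma hasFID_iff : HasFID A Y ↔
    ∃ n, ∀ (N : Type) [AddCommGroup N] [Module A N], ∀ m, n < m → EV A m N Y := by
  unfold HasFID
  simp only [ext1_subsingleton_iff]

lemma hasFID_retract (h : HasFID A Y) (s : Y' →ₗ[A] Y) (r : Y →ₗ[A] Y')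
    (hrs : r ∘ₗ s = LinearMap.id) : HasFID A Y' := by
  rw [hasFID_iff] at *
  obtain ⟨n, hn⟩ := h
  exact ⟨n, fun N _ _ m hm => (hn N m hm).retract_right s r hrs⟩

lemma hasFID_congr (h : HasFID A Y) (e : Y ≃ₗ[A] Y') : HasFID A Y' :=
  hasFID_retract h e.symm.toLinearMap e.toLinearMap (by ext; simp)

lemma hasFID_hom_free (h : HasFID A Y) (k : ℕ) : HasFID A ((Fin k → A) →ₗ[A] Y) := by
  rw [hasFID_iff] at *
  obtain ⟨n, hn⟩ := h
  exact ⟨n, fun N _ _ m hm => (hn N m hm).hom_free k⟩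

lemma hasFID_of_subsingleton [Subsingleton Y] : HasFID A Y :=
  hasFID_iff.2 ⟨0, fun _ _ _ m _ => EV_of_subsingleton_right m⟩

lemma hasFID_coker {f : M₁ →ₗ[A] M₂} {g : M₂ →ₗ[A] M₃} (hf : Function.Injective f)
    (hfg : Function.Exact f g) (hg : Function.Surjective g) (h₁ : HasFID A M₁) (h₂ : HasFID A M₂) :
    HasFID A M₃ := by
  rw [hasFID_iff] at *
  obtain ⟨a, ha⟩ := h₁
  obtain ⟨b, hb⟩ := h₂
  exact ⟨max a b, fun N _ _ m hm => EV.cov₃ hf hfg hg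
    (hb N m ((le_max_right _ _).trans_lt hm)) (ha N (m + 1) (by omega))⟩

end hasFID

section approximation

variable {A : Type} [CommRing A] [IsNoetherianRing A] [IsLocalRing A]
variable {d : ℕ} {ω : Type} [AddCommGroup ω] [Module A ω]

/-- A maximal Cohen-Macaulay module embeds in a power of `ω` with maximal Cohen-Macaulay
cokernel. -/
lemma Good.exists_embedding (G : Good A ω d) {Z : Type} [AddCommGroup Z] [Module A Z]
    [Module.Finite A Z] (hZ : depthGE A d Z) :
    ∃ (n : ℕ) (V : Type) (_ : AddCommGroup V) (_ : Module A V)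
      (i : Z →ₗ[A] ((Fin n → A) →ₗ[A] ω)) (c : ((Fin n → A) →ₗ[A] ω) →ₗ[A] V),
      depthGE A d V ∧ Function.Injective i ∧ Function.Exact i c ∧ Function.Surjective c := by
  have := G.fin
  have := G.finite_dual Z
  obtain ⟨n, q, hq⟩ := Module.Finite.exists_fin' A (Z →ₗ[A] ω)
  have hZ' := G.mcm_dual hZ
  have hex := exact_ker_subtype q
  have hL : depthGE A d (LinearMap.ker q) :=
    depthGE.ker' (f := (LinearMap.ker q).subtype) Subtype.val_injective hex hq (G.depth_free n) hZ'
  have hs := dmap_surjective (f := (LinearMap.ker q).subtype) Subtype.val_injective hex hq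
    (G.ev_one hZ')
  have hδ := G.delta_bijective hZ
  refine ⟨n, _, _, _, dmap A ω q ∘ₗ deltaMap A ω Z, dmap A ω (LinearMap.ker q).subtype,
    G.mcm_dual hL, (dmap_injective ω hq).comp hδ.1, fun x => ?_, hs⟩
  rw [dmap_exact ω hex hq x]
  constructor
  · rintro ⟨y, rfl⟩
    obtain ⟨z, rfl⟩ := hδ.2 y
    exact ⟨z, rfl⟩
  · rintro ⟨z, rfl⟩
    exact ⟨_, rfl⟩

/-- Auslander-Buchweitz approximation. -/
lemma Good.exists_approximation (G : Good A ω d) (hω : HasFID A ω) (k : ℕ) {N : Type}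
    [AddCommGroup N] [Module A N] [Module.Finite A N] (hk : k ≤ d) (hN : depthGE A (d - k) N) :
    ∃ (Z : Type) (_ : AddCommGroup Z) (_ : Module A Z) (q : Z →ₗ[A] N), Module.Finite A Z ∧
      depthGE A d Z ∧ Function.Surjective q ∧ HasFID A (LinearMap.ker q) := by
  have := G.fin
  induction k generalizing N with
  | zero =>
    refine ⟨N, _, _, LinearMap.id, inferInstance, hN, Function.surjective_id, ?_⟩
    rw [LinearMap.ker_id]
    exact hasFID_of_subsingleton
  | succ k ih =>
    obtain ⟨n, p, hp⟩ := Module.Finite.exists_fin' A N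
    let L := LinearMap.ker p
    have hL : depthGE A (d - k) L := by
      rw [show d - k = d - (k + 1) + 1 by omega]
      exact depthGE.ker (f := L.subtype) Subtype.val_injective (exact_ker_subtype p) hp
        ((G.depth_free n).mono (by omega)) hN
    obtain ⟨Z, _, _, q, _, hZ, hq, hY⟩ := ih (by omega) hL
    obtain ⟨m, V, _, _, i, c, hV, hi, hic, hc⟩ := G.exists_embedding hZ
    let W := (Fin m → A) →ₗ[A] ω
    let Q := ((Fin n → A) × W) ⧸ LinearMap.range ((L.subtype ∘ₗ q).prod i)
    let π : ((Fin n → A) × W) →ₗ[A] Q := Submodule.mkQ _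
    have hπ : Function.Surjective π := Submodule.mkQ_surjective _
    have hπ0 {x : Fin n → A} {w : W} : π (x, w) = 0 ↔ ∃ z, (q z : Fin n → A) = x ∧ i z = w := by
      rw [← LinearMap.mem_ker, Submodule.ker_mkQ, LinearMap.mem_range]
      exact exists_congr fun z => Prod.ext_iff
    have hmove (z : Z) (x : Fin n → A) (w : W) : π (x - q z, w) = π (x, w + i z) := by
      have h := hπ0.2 ⟨z, rfl, rfl⟩
      rw [← add_zero (π _), ← h, ← map_add]
      simp
    let toV : Q →ₗ[A] V := desc π hπ (c ∘ₗ LinearMap.snd A _ _) (by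
      rintro ⟨x, w⟩ h
      obtain ⟨z, -, rfl⟩ := hπ0.1 h
      exact hic.apply_apply_eq_zero z)
    let toN : Q →ₗ[A] N := desc π hπ (p ∘ₗ LinearMap.fst A _ _) (by
      rintro ⟨x, w⟩ h
      obtain ⟨z, rfl, -⟩ := hπ0.1 h
      exact (q z).2)
    have hQ : depthGE A d Q := fun j hj => by
      refine EV.cov₂ (f := π ∘ₗ LinearMap.inl A _ _) (g := toV) ?_ ?_ ?_ (G.depth_free n j hj)
        (hV j hj)
      · rw [← LinearMap.ker_eq_bot, LinearMap.ker_eq_bot']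
        intro x hx
        obtain ⟨z, rfl, hz⟩ := hπ0.1 hx
        rw [hi (hz.trans (map_zero i).symm), map_zero, Submodule.coe_zero]
      · intro y
        obtain ⟨⟨x, w⟩, rfl⟩ := hπ y
        constructor
        · intro h
          obtain ⟨z, rfl⟩ := (hic w).1 (by simpa [toV] using h)
          exact ⟨x - q z, (hmove z x 0).trans (by rw [zero_add])⟩
        · rintro ⟨x', h⟩
          rw [← h]
          simp [toV]
      · intro v
        obtain ⟨w, rfl⟩ := hc v
        exact ⟨π (0, w), by simp [toV]⟩
    refine ⟨Q, _, _, toN, inferInstance, hQ, ?_, ?_⟩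
    · intro y
      obtain ⟨x, rfl⟩ := hp y
      exact ⟨π (x, 0), by simp [toN]⟩
    · let g : W →ₗ[A] LinearMap.ker toN := (π ∘ₗ LinearMap.inr A _ _).codRestrict _ (fun w => by
        simp [toN])
      have hg (w : W) : (g w : Q) = π (0, w) := rfl
      refine hasFID_coker (f := i ∘ₗ (LinearMap.ker q).subtype) (g := g)
        (hi.comp Subtype.val_injective) (fun w => ?_) ?_ hY (hasFID_hom_free hω m)
      · rw [← Subtype.coe_inj, hg, Submodule.coe_zero, hπ0]
        constructor
        · rintro ⟨z, hz, rfl⟩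
          exact ⟨⟨z, Subtype.ext hz⟩, rfl⟩
        · rintro ⟨z, rfl⟩
          exact ⟨z, congrArg Subtype.val z.2, rfl⟩
      · rintro ⟨y, hy⟩
        obtain ⟨⟨x, w⟩, rfl⟩ := hπ y
        have hx : p x = 0 := by simpa [toN] using hy
        obtain ⟨z, hz⟩ := hq ⟨x, hx⟩
        refine ⟨w + -(i z), Subtype.ext ?_⟩
        rw [hg, ← map_neg, ← hmove, map_neg, hz]
        simp

end approximation

lemma serreS_congr {A : Type} [CommRing A] [IsNoetherianRing A] [IsLocalRing A] {n : ℕ}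
    {N N' : Type}
    [AddCommGroup N] [Module A N] [AddCommGroup N'] [Module A N'] (h : SerreS A n N)
    (e : N ≃ₗ[A] N') : SerreS A n N' := by
  rw [serreS_iff] at *
  exact fun p => (h p).congr (IsLocalizedModule.mapEquiv p.asIdeal.primeCompl
    (LocalizedModule.mkLinearMap p.asIdeal.primeCompl N)
    (LocalizedModule.mkLinearMap p.asIdeal.primeCompl N') (Localization.AtPrime p.asIdeal) e)

section backward

variable {A : Type} [CommRing A] [IsNoetherianRing A] [IsLocalRing A]
variable {d : ℕ} {ω : Type} [AddCommGroup ω] [Module A ω]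
variable {M X : Type} [AddCommGroup M] [Module A M] [AddCommGroup X] [Module A X] {μ : M →ₗ[A] X}
  [Module.Finite A M] [Module.Finite A X]

lemma Good.dmap_surjective_of_preenvelope (G : Good A ω d) (h : IsCMPreenvelope A d μ) :
    Function.Surjective (dmap A ω μ) :=
  fun f => h.2 ω (isMCM_iff.2 ⟨G.fin, G.depthW⟩) f

lemma Good.ev_one_coker (G : Good A ω d) (h : IsCMPreenvelope A d μ) :
    EV A 1 (X ⧸ LinearMap.range μ) ω := by
  have hX := (isMCM_iff.1 h.1).2
  refine EV_one_of_extend (f := (LinearMap.range μ).subtype) Subtype.val_injective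
    (exact_subtype_mkQ _) (Submodule.mkQ_surjective _) (fun ψ => ?_) (G.ev_one hX)
  obtain ⟨g, hg⟩ := G.dmap_surjective_of_preenvelope h (ψ ∘ₗ μ.rangeRestrict)
  refine ⟨g, ?_⟩
  ext y
  obtain ⟨x, rfl⟩ := μ.surjective_rangeRestrict y
  exact LinearMap.congr_fun hg x

lemma Good.codGT_ker_of_preenvelope (G : Good A ω d) (h : IsCMPreenvelope A d μ) :
    codGT A d (LinearMap.ker μ) 0 := by
  refine codGT_of_heights G.dim fun p hp x => ?_
  have hp' : ht p ≤ 0 := by rw [← coe_ht] at hp; exact_mod_cast hp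
  obtain ⟨s, hs⟩ := exists_smul_eq_zero_of_loc (W := ω) p.asIdeal.primeCompl
    ((G.loc p).delta_bijective (fun i hi => by omega)).1 x.1 (by
      ext f
      obtain ⟨g, rfl⟩ := G.dmap_surjective_of_preenvelope h f
      change g (μ x) = 0
      rw [x.2, map_zero])
  exact ⟨s, s.2, Subtype.ext hs⟩

lemma Good.hasFID_dual_coker (G : Good A ω d) (hω : HasFID A ω) (h : IsCMEnvelope A d μ) :
    HasFID A ((X ⧸ LinearMap.range μ) →ₗ[A] ω) := by
  have := G.fin
  have := G.finite_dual X
  have := G.finite_dual M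
  obtain ⟨hpre, henv⟩ := h
  have hX := (isMCM_iff.1 hpre.1).2
  obtain ⟨Z, _, _, q, _, hZ, hq, hY⟩ := G.exists_approximation hω d (N := M →ₗ[A] ω) le_rfl
    (fun i hi => by omega)
  obtain ⟨n, hn⟩ := EVbound_of_hasFID hY
  obtain ⟨a, ha⟩ := EV.exists_lift (f := (LinearMap.ker q).subtype) Subtype.val_injective
    (exact_ker_subtype q) hq (hn.ev_one G (G.mcm_dual hX)) (dmap A ω μ)
  have := G.finite_dual Z
  obtain ⟨g, hg⟩ := hpre.2 (Z →ₗ[A] ω) (isMCM_iff.2 ⟨inferInstance, G.mcm_dual hZ⟩)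
    (dmap A ω q ∘ₗ deltaMap A ω M)
  let b : Z →ₗ[A] (X →ₗ[A] ω) := dmap A ω g ∘ₗ deltaMap A ω Z
  have hb : dmap A ω μ ∘ₗ b = q := by
    ext z m
    exact LinearMap.congr_fun (LinearMap.congr_fun hg m) z
  obtain ⟨φ, hφ⟩ := exists_dmap_eq (G.delta_bijective hX) (b ∘ₗ a)
  have hφμ : φ ∘ₗ μ = μ := dmap_injective_hom (G.delta_bijective hX).1 (by
    rw [dmap_comp, hφ, ← LinearMap.comp_assoc, hb, ha])
  let e := LinearEquiv.ofBijective φ (henv φ hφμ)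
  have he1 : φ ∘ₗ e.symm.toLinearMap = LinearMap.id := by
    ext x; exact e.apply_symm_apply x
  have he2 : e.symm.toLinearMap ∘ₗ μ = μ := by
    ext m
    exact e.symm_apply_eq.2 (LinearMap.congr_fun hφμ m).symm
  let b' := dmap A ω e.symm.toLinearMap ∘ₗ b
  have hb' : dmap A ω μ ∘ₗ b' = q := by
    rw [← LinearMap.comp_assoc, ← dmap_comp, he2, hb]
  have hba : b' ∘ₗ a = LinearMap.id := by
    rw [LinearMap.comp_assoc, ← hφ, ← dmap_comp, he1]; rfl
  have hK : HasFID A (LinearMap.ker (dmap A ω μ)) := by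
    refine hasFID_retract hY (a.restrict (p := LinearMap.ker (dmap A ω μ)) (fun x hx => ?_))
      (b'.restrict (p := LinearMap.ker q) (fun z hz => ?_)) ?_
    · exact (LinearMap.congr_fun ha x).trans hx
    · exact (LinearMap.congr_fun hb' z).trans hz
    · ext1 x
      exact Subtype.ext (LinearMap.congr_fun hba x)
  have hex := dmap_exact ω (LinearMap.exact_map_mkQ_range μ) (Submodule.mkQ_surjective _)
  rw [hex.linearMap_ker_eq] at hK
  exact hasFID_congr hK (LinearEquiv.ofInjective _
    (dmap_injective ω (Submodule.mkQ_surjective (LinearMap.range μ)))).symm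

/-- The projection of the target of an envelope onto a free quotient killing the source vanishes. -/
lemma noNonzeroFreeSummand_of_envelope {T : Type} [AddCommGroup T] [Module A T]
    (h : IsCMEnvelope A d μ) (u : (X ⧸ LinearMap.range μ) →ₗ[A] T) :
    NoNonzeroFreeSummand A (LinearMap.range u) := by
  intro F F' hF _
  let t : X →ₗ[A] F := F.projectionOnto F' hF ∘ₗ u.rangeRestrict ∘ₗ Submodule.mkQ _
  have ht : Function.Surjective t :=
    (Submodule.projectionOnto_surjective hF).comp
      (u.surjective_rangeRestrict.comp (Submodule.mkQ_surjective _))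
  have htμ (m : M) : t (μ m) = 0 := by
    have : Submodule.mkQ (LinearMap.range μ) (μ m) = 0 :=
      (Submodule.Quotient.mk_eq_zero _).2 ⟨m, rfl⟩
    simp only [t, LinearMap.comp_apply, this, map_zero]
  obtain ⟨σ, hσ⟩ := Module.projective_lifting_property t LinearMap.id ht
  have hσ' (y : F) : t (σ y) = y := LinearMap.congr_fun hσ y
  have hφ := h.2 (LinearMap.id - σ ∘ₗ t) (by ext m; simp [htμ])
  rw [Submodule.eq_bot_iff]
  intro y hy
  have h1 : σ ⟨y, hy⟩ = 0 := hφ.1 (by simp [hσ'])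
  have h2 := hσ' ⟨y, hy⟩
  rw [h1, map_zero] at h2
  exact (congrArg Subtype.val h2).symm

lemma Good.exists_exact_of_isCMEnvelope (G : Good A ω d) (hω : HasFID A ω)
    (h : IsCMEnvelope A d μ) :
    ∃ (S T U : ModuleCat.{0} A) (a : S →ₗ[A] (X ⧸ LinearMap.range μ))
      (u : (X ⧸ LinearMap.range μ) →ₗ[A] T) (c : T →ₗ[A] U),
      Module.Finite A S ∧ Module.Finite A T ∧ Module.Finite A U ∧
      Function.Injective a ∧ Function.Exact a u ∧ Function.Exact u c ∧ Function.Surjective c ∧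
      codGT A d S 1 ∧ codGT A d U 2 ∧ SerreS A 2 T ∧ HasFID A (T →ₗ[A] ω) ∧
      SerreS A 3 (T →ₗ[A] ω) ∧ NoNonzeroFreeSummand A (LinearMap.range u) := by
  have := G.fin
  let C := X ⧸ LinearMap.range μ
  have := G.finite_dual C
  have := G.finite_dual (C →ₗ[A] ω)
  have hX := (isMCM_iff.1 h.1.1).2
  have hC := G.ev_one_coker h.1
  have hS := G.codGT_ker_delta hC
  have hU := G.codGT_coker_delta hC
  have hex := exact_ker_subtype (deltaMap A ω C)
  have hex' := LinearMap.exact_map_mkQ_range (deltaMap A ω C)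
  let e := LinearEquiv.ofBijective _ (G.dmap_bijective hex hex' (Submodule.mkQ_surjective _)
    (codGT_mono (Nat.zero_le 1) hS) (codGT_mono one_le_two hU))
  refine ⟨ModuleCat.of A (LinearMap.ker (deltaMap A ω C)),
    ModuleCat.of A ((C →ₗ[A] ω) →ₗ[A] ω), ModuleCat.of A (_ ⧸ LinearMap.range (deltaMap A ω C)),
    (LinearMap.ker (deltaMap A ω C)).subtype, deltaMap A ω C, Submodule.mkQ _,
    ?_, ?_, ?_, Subtype.val_injective, hex, hex', Submodule.mkQ_surjective _, hS, hU,
    G.serreS_dual _, ?_, ?_, noNonzeroFreeSummand_of_envelope h _⟩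
  · exact inferInstanceAs (Module.Finite A (LinearMap.ker (deltaMap A ω C)))
  · assumption
  · exact inferInstanceAs (Module.Finite A (_ ⧸ LinearMap.range (deltaMap A ω C)))
  · exact hasFID_congr (G.hasFID_dual_coker hω h) e.symm
  · exact serreS_congr (G.serreS_three hX (LinearMap.exact_map_mkQ_range μ)
      (Submodule.mkQ_surjective _) (G.dmap_surjective_of_preenvelope h.1)) e.symm

end backward

end CMEnv

/-- over a Henselian CM local ring, `μ : M → X` with `X` maximal Cohen-Macaulay
is a CM-envelope iff `cod (ker μ) > 0` and there is an exact sequence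
`0 → S → coker μ →u T → U → 0` with `cod S > 1`, `cod U > 2`, `T` satisfying `(S_2)`,
`T†` of finite injective dimension satisfying `(S_3)`, and `im u` having no nonzero free
direct summand. -/
theorem cm_envelope_iff_exact_seq (R : Type) [CommRing R] [IsNoetherianRing R]
    [HenselianLocalRing R]
    (d : ℕ) (hdim : ringKrullDim R = d) (hCM : (d : ℕ∞) ≤ rdepth R R)
    (ω : Type) [AddCommGroup ω] [Module R ω] (hω : IsCanonicalModule R d ω)
    (M X : Type) [AddCommGroup M] [Module R M] [AddCommGroup X] [Module R X]
    [Module.Finite R M] (hX : IsMCM R d X) (μ : M →ₗ[R] X) :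
    IsCMEnvelope R d μ ↔
      codGT R d ↥(LinearMap.ker μ) 0 ∧
        ∃ (S T U : ModuleCat.{0} R) (a : ↥S →ₗ[R] (X ⧸ LinearMap.range μ))
            (u : (X ⧸ LinearMap.range μ) →ₗ[R] ↥T) (c : ↥T →ₗ[R] ↥U),
          Module.Finite R ↥S ∧ Module.Finite R ↥T ∧ Module.Finite R ↥U ∧
          Function.Injective a ∧ Function.Exact a u ∧ Function.Exact u c ∧
          Function.Surjective c ∧
          codGT R d ↥S 1 ∧ codGT R d ↥U 2 ∧ SerreS R 2 ↥T ∧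
          HasFID R (↥T →ₗ[R] ω) ∧ SerreS R 3 (↥T →ₗ[R] ω) ∧
          NoNonzeroFreeSummand R ↥(LinearMap.range u) := by
  have G := CMEnv.good_of_canonical hdim hCM hω
  obtain ⟨_, hX⟩ := CMEnv.isMCM_iff.1 hX
  constructor
  · intro h
    exact ⟨G.codGT_ker_of_preenvelope h.1, G.exists_exact_of_isCMEnvelope hω.2.1 h⟩
  · rintro ⟨hK, S, T, U, a, u, c, _, _, _, ha, hau, huc, hc, hS, hU, hT, hid, hT', hu⟩
    exact G.isCMEnvelope_of_exact hX hK ha hau huc hc hS hU hT hid hT' hu
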